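/- arXiv:1704.03898 — 4 statements merged into one kernel-verified Lean document; each statement's English description precedes it below -/
import Mathlib

section
/- (Sauer) The Rado graph has finite big Ramsey degrees: for every finite graph G there is a positive integer n(G) such that for every Rado graph R and every coloring of the set of induced subgraphs of R isomorphic to G into finitely many colors, there is an induced subgraph R' of R isomorphic to R such that the induced subgraphs of R' isomorphic to G take no more than n(G) colors. -/
/-- The extension property (defining Rado graphs): for all disjoint finite sets `U, W` of
vertices there is a vertex (outside `U ∪ W`) adjacent to every vertex of `U` and to no
vertex of `W`. -/
def ExtensionProperty {V : Type} (R : SimpleGraph V) : Prop :=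
  ∀ U W : Finset V, Disjoint U W →
    ∃ v : V, v ∉ U ∧ v ∉ W ∧ (∀ u ∈ U, R.Adj v u) ∧ (∀ w ∈ W, ¬ R.Adj v w)

section ultrafilter

open Filter

attribute [local instance] Ultrafilter.semigroup

/-- A compact right topological semigroup has a nonempty left ideal in which all idempotents are
right identities. -/
theorem exists_leftIdeal_mul_idempotent_eq {M : Type*} [Nonempty M] [Semigroup M]
    [TopologicalSpace M] [CompactSpace M] [T2Space M] (hM : ∀ r : M, Continuous (· * r)) :
    ∃ I : Set M, I.Nonempty ∧ (∀ x, ∀ y ∈ I, x * y ∈ I) ∧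
      ∀ x ∈ I, ∀ e ∈ I, e * e = e → x * e = x := by
  let S : Set (Set M) := {I | IsClosed I ∧ I.Nonempty ∧ ∀ x, ∀ y ∈ I, x * y ∈ I}
  obtain ⟨I, hI⟩ : ∃ I, Minimal (· ∈ S) I := by
    refine zorn_superset _ fun c hcs hc ↦ ?_
    refine ⟨⋂₀ c, ⟨isClosed_sInter fun t ht ↦ (hcs ht).1, ?_, fun x y hy t ht ↦
      (hcs ht).2.2 x y (hy t ht)⟩, fun s hs ↦ Set.sInter_subset_of_mem hs⟩
    obtain rfl | hcne := c.eq_empty_or_nonempty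
    · simp
    · have := hcne.coe_sort
      exact IsCompact.nonempty_sInter_of_directed_nonempty_isCompact_isClosed
        (IsChain.directedOn hc.symm) (fun U hU ↦ (hcs hU).2.1) (fun U hU ↦ (hcs hU).1.isCompact)
        fun U hU ↦ (hcs hU).1
  obtain ⟨-, hne, hmul⟩ := hI.prop
  refine ⟨I, hne, hmul, fun x hx e he hee ↦ ?_⟩
  have key : Set.range (· * e) = I := by
    apply hI.eq_of_subset
    · refine ⟨(isCompact_range (hM e)).isClosed, Set.range_nonempty _, ?_⟩
      rintro x _ ⟨y, rfl⟩
      exact ⟨x * y, mul_assoc _ _ _⟩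
    · rintro _ ⟨y, rfl⟩
      exact hmul y e he
  rw [← key] at hx
  obtain ⟨d, rfl⟩ := hx
  simp only [mul_assoc, hee]

theorem Ultrafilter.map_mul_of_mulHom {M N : Type*} [Semigroup M] [Semigroup N] (f : M →ₙ* N)
    (p q : Ultrafilter M) : (p * q).map f = p.map f * q.map f := by
  apply Ultrafilter.coe_inj.mp
  apply Filter.ext'
  intro P
  rw [Ultrafilter.eventually_mul]
  simp only [Ultrafilter.coe_map, Filter.eventually_map, Ultrafilter.eventually_mul, map_mul]

/-- Substituting the letter `a` for the variable `none`. -/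
abbrev substVar {α : Type*} (a : α) : FreeMonoid (Option α) →* FreeMonoid α :=
  FreeMonoid.map (·.getD a)

theorem exists_ultrafilter_substVar (α : Type*) :
    ∃ (p : Ultrafilter (FreeMonoid α)) (q : Ultrafilter (FreeMonoid (Option α))),
      (∀ᶠ w in q, ∃ v, w = FreeMonoid.of (none : Option α) * v) ∧ (∀ a, p * q.map (substVar a) = p) ∧
        ∀ a b, q.map (substVar a) * q.map (substVar b) = q.map (substVar a) := by
  obtain ⟨I, ⟨p, hp⟩, hmul, hI⟩ := exists_leftIdeal_mul_idempotent_eq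
    (Ultrafilter.continuous_mul_left (M := FreeMonoid α))
  let p' : Ultrafilter (FreeMonoid (Option α)) := p.map (FreeMonoid.map some)
  have hp' (a : α) : p'.map (substVar a) = p := by
    rw [Ultrafilter.map_map]
    convert Ultrafilter.map_id p
    ext x
    simp [← MonoidHom.comp_apply, ← FreeMonoid.map_comp, Function.comp_def, ← Function.id_def]
  let L : Set (FreeMonoid (Option α)) := {w | ∃ v, w = FreeMonoid.of none * v}
  have hL (x : Ultrafilter (FreeMonoid (Option α))) :
      x ∈ {x : Ultrafilter (FreeMonoid (Option α)) | L ∈ x} ↔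
        ∀ᶠ w in (x : Filter _), ∃ v, w = FreeMonoid.of (none : Option α) * v := Set.mem_ofPred
  obtain ⟨q, ⟨hqL, d, hd⟩, hqq⟩ := exists_idempotent_in_compact_subsemigroup
    (Ultrafilter.continuous_mul_left (M := FreeMonoid (Option α)))
    ({x | L ∈ x} ∩ Set.range (· * p'))
    (by
      refine ⟨pure (FreeMonoid.of none) * p', ?_, _, rfl⟩
      rw [hL, Ultrafilter.eventually_mul]
      simp)
    ((ultrafilter_isClosed_basic L).isCompact.inter
      (isCompact_range (Ultrafilter.continuous_mul_left p')))
    (by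
      rintro x ⟨hx, -⟩ _ ⟨-, y, rfl⟩
      refine ⟨?_, x * y, mul_assoc _ _ _⟩
      rw [hL, Ultrafilter.eventually_mul]
      filter_upwards [(hL x).1 hx]
      rintro _ ⟨v, rfl⟩
      exact Eventually.of_forall fun w ↦ ⟨v * w, mul_assoc _ _ _⟩)
  have hmap (a : α) (x y : Ultrafilter (FreeMonoid (Option α))) :
      (x * y).map (substVar a) = x.map (substVar a) * y.map (substVar a) :=
    Ultrafilter.map_mul_of_mulHom (substVar a : FreeMonoid (Option α) →ₙ* FreeMonoid α) x y
  have hqI (a : α) : q.map (substVar a) ∈ I := by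
    rw [← hd, hmap, hp']
    exact hmul _ _ hp
  have hqi (a : α) : q.map (substVar a) * q.map (substVar a) = q.map (substVar a) := by
    rw [← hmap, hqq]
  exact ⟨p, q, hqL, fun a ↦ hI _ hp _ (hqI a) (hqi a), fun a b ↦ hI _ (hqI a) _ (hqI b) (hqi b)⟩

/-- The word obtained from `w₀` by appending, for each letter `a` of the given (reversed) word,
the corresponding left variable word with `a` substituted for the variable. -/
def appendBlocks {α : Type*} (w₀ : List α) (w : ℕ → List (Option α)) : List α → List α
  | [] => w₀
  | a :: l => appendBlocks w₀ w l ++ a :: (w l.length).map (·.getD a)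

/-- The left variable version of the infinite Hales–Jewett theorem, due to Carlson and Simpson. -/
theorem exists_appendBlocks_mono {α κ : Type*} [Finite α] [Finite κ] (c : List α → κ) :
    ∃ (w₀ : List α) (w : ℕ → List (Option α)) (k : κ), ∀ l, c (appendBlocks w₀ w l) = k := by
  obtain ⟨p, q, hq, hpq, hqq⟩ := exists_ultrafilter_substVar α
  obtain ⟨k, hk⟩ : ∃ k, ∀ᶠ s in (p : Filter (FreeMonoid α)), c s.toList = k :=
    Ultrafilter.eventually_exists_iff.1 (Eventually.of_forall fun s ↦ ⟨_, rfl⟩)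
  let G : Set (FreeMonoid α) :=
    {s | c s.toList = k ∧ ∀ a, ∀ᶠ w in q, c (s * substVar a w).toList = k}
  have hG : ∀ᶠ s in p, s ∈ G := by
    refine hk.and (eventually_all.2 fun a ↦ ?_)
    rw [← hpq a, Ultrafilter.eventually_mul] at hk
    simpa using hk
  have hstep : ∀ s ∈ G, ∀ a, ∀ᶠ w in q, s * substVar a w ∈ G := by
    rintro s ⟨-, hs⟩ a
    refine (hs a).and (eventually_all.2 fun b ↦ ?_)
    have h : ∀ᶠ w in q.map (substVar a), c (s * w).toList = k := by simpa using hs a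
    rw [← hqq a b, Ultrafilter.eventually_mul] at h
    simpa [mul_assoc] using h
  have hfin (T : Set (FreeMonoid α)) (hT : T.Finite) (hTG : T ⊆ G) :
      ∃ v : List (Option α), ∀ s ∈ T, ∀ a, s * substVar a (FreeMonoid.of none *
        FreeMonoid.ofList v) ∈ G := by
    have h : ∀ᶠ w in q, ∀ s ∈ T, ∀ a, s * substVar a w ∈ G :=
      (eventually_all_finite hT).2 fun s hs ↦ eventually_all.2 (hstep s (hTG hs))
    obtain ⟨_, h, v, rfl⟩ := (h.and hq).exists
    exact ⟨v.toList, h⟩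
  obtain ⟨s₀, hs₀⟩ := hG.exists
  choose! v hv using hfin
  let next (T : Set (FreeMonoid α)) : Set (FreeMonoid α) :=
    (fun x : FreeMonoid α × α ↦
      x.1 * substVar x.2 (FreeMonoid.of none * FreeMonoid.ofList (v T))) '' (T ×ˢ Set.univ)
  let T (n : ℕ) : Set (FreeMonoid α) := next^[n] {s₀}
  have hTs (n : ℕ) : T (n + 1) = next (T n) := Function.iterate_succ_apply' _ _ _
  have hT (n : ℕ) : (T n).Finite ∧ T n ⊆ G := by
    induction n with
    | zero => exact ⟨Set.finite_singleton _, by simpa [T] using hs₀⟩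
    | succ n ih =>
      rw [hTs]
      refine ⟨(ih.1.prod Set.finite_univ).image _, ?_⟩
      rintro _ ⟨⟨s, a⟩, ⟨hs, -⟩, rfl⟩
      exact hv _ ih.1 ih.2 s hs a
  refine ⟨s₀.toList, fun n ↦ v (T n), k, fun l ↦ ?_⟩
  suffices h : FreeMonoid.ofList (appendBlocks s₀.toList (fun n ↦ v (T n)) l) ∈ T l.length from
    ((hT _).2 h).1
  induction l with
  | nil => simp [appendBlocks, T]
  | cons a l ih =>
    rw [List.length_cons, hTs]
    exact ⟨(_, a), ⟨ih, trivial⟩, rfl⟩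

end ultrafilter

/-- A rigid map is substitution of finite words into an infinite parameter word: the block
`a :: z` is appended for each letter `a`, where `z` uses only letters seen so far. -/
structure IsRigid (F : List ℕ → List ℕ) : Prop where
  map : ∀ (g : ℕ → ℕ) u, F (u.map g) = (F u).map g
  nil : F [] = []
  concat : ∀ u a, ∃ z ⊆ u ++ [a], F (u ++ [a]) = F u ++ a :: z

namespace IsRigid

variable {F X : List ℕ → List ℕ}

theorem subset (hF : IsRigid F) (u : List ℕ) : F u ⊆ u := by
  induction u using List.reverseRecOn with
  | nil => simp [hF.nil]
  | append_singleton u a ih =>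
    obtain ⟨z, hz, h⟩ := hF.concat u a
    rw [h]
    intro x hx
    have := @ih x
    have := @hz x
    simp at *
    tauto

theorem append (hF : IsRigid F) (u v : List ℕ) :
    ∃ z ⊆ u ++ v, F (u ++ v) = F u ++ z := by
  induction v using List.reverseRecOn with
  | nil => exact ⟨[], by simp⟩
  | append_singleton v a ih =>
    obtain ⟨z, hz, h⟩ := ih
    obtain ⟨y, hy, h'⟩ := hF.concat (u ++ v) a
    refine ⟨z ++ a :: y, ?_, by simp [← List.append_assoc, h', h]⟩
    intro x hx
    have := @hy x
    have := @hz x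
    simp at *
    tauto

theorem append_cons (hF : IsRigid F) (u v : List ℕ) (a : ℕ) :
    ∃ z ⊆ u ++ a :: v, F (u ++ a :: v) = F u ++ a :: z := by
  obtain ⟨z, hz, h⟩ := hF.append (u ++ [a]) v
  obtain ⟨y, hy, h'⟩ := hF.concat u a
  refine ⟨y ++ z, ?_, by simpa [h'] using h⟩
  intro x hx
  have := @hy x
  have := @hz x
  simp at *
  tauto

protected theorem id : IsRigid id := ⟨fun _ _ ↦ rfl, rfl, fun _ _ ↦ ⟨[], by simp⟩⟩

theorem comp (hF : IsRigid F) (hX : IsRigid X) : IsRigid (F ∘ X) where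
  map g u := by simp [hF.map, hX.map]
  nil := by simp [hF.nil, hX.nil]
  concat u a := by
    obtain ⟨z, hz, h⟩ := hX.concat u a
    obtain ⟨y, hy, h'⟩ := hF.append_cons (X u) z a
    refine ⟨y, ?_, by simp [h, h']⟩
    intro x hx
    have := @hy x
    have := @hz x
    have : x ∈ X u → x ∈ u := fun h ↦ hX.subset u h
    simp at *
    tauto

theorem length_eq (hF : IsRigid F) (u : List ℕ) :
    (F u).length = (F (List.range u.length)).length := by
  have h : u = (List.range u.length).map (u.getD · 0) := by
    apply List.ext_getElem <;> simp
    grind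
  conv_lhs => rw [h, hF.map]
  simp

theorem length_congr (hF : IsRigid F) {u v : List ℕ} (h : u.length = v.length) :
    (F u).length = (F v).length := by
  rw [hF.length_eq u, hF.length_eq v, h]

theorem getElem?_length (hF : IsRigid F) {u v : List ℕ} (h : u.length < v.length) :
    (F u).length < (F v).length ∧ (F v)[(F u).length]? = v[u.length]? := by
  obtain ⟨z, -, hz⟩ := hF.append_cons (v.take u.length) (v.drop (u.length + 1)) v[u.length]
  have hv : v.take u.length ++ v[u.length] :: v.drop (u.length + 1) = v := by simp
  rw [hv] at hz
  have hl : (F u).length = (F (v.take u.length)).length :=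
    hF.length_congr (by simp; omega)
  rw [hz, hl]
  simp [h]

theorem injective (hF : IsRigid F) : Function.Injective F := by
  intro u v h
  have hl : u.length = v.length := by
    by_contra hne
    rcases Nat.lt_or_gt_of_ne hne with hlt | hlt
    · exact (hF.getElem?_length hlt).1.ne (by rw [h])
    · exact (hF.getElem?_length hlt).1.ne (by rw [h])
  apply List.ext_getElem?
  intro i
  by_cases hi : i < u.length
  · have h1 := (hF.getElem?_length (u := List.range i) (v := u) (by simpa)).2
    have h2 := (hF.getElem?_length (u := List.range i) (v := v) (by simpa [← hl])).2
    rw [h, h2] at h1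
    simpa using h1.symm
  · simp at hi
    rw [List.getElem?_eq_none hi, List.getElem?_eq_none (hl ▸ hi)]

end IsRigid

/-- The rigid map with blocks `i :: s i`, on reversed words. -/
def ofBlocksAux (s : ℕ → List ℕ) : List ℕ → List ℕ
  | [] => []
  | a :: r => ofBlocksAux s r ++ a :: (s r.length).map ((r.reverse ++ [a]).getD · 0)

/-- The rigid map with blocks `i :: s i`. -/
def ofBlocks (s : ℕ → List ℕ) (u : List ℕ) : List ℕ := ofBlocksAux s u.reverse

theorem ofBlocks_concat (s : ℕ → List ℕ) (u : List ℕ) (a : ℕ) :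
    ofBlocks s (u ++ [a]) =
      ofBlocks s u ++ a :: (s u.length).map ((u ++ [a]).getD · 0) := by
  simp [ofBlocks, ofBlocksAux]

theorem isRigid_ofBlocks (s : ℕ → List ℕ) (hs : ∀ i, ∀ x ∈ s i, x ≤ i) :
    IsRigid (ofBlocks s) where
  map g u := by
    induction u using List.reverseRecOn with
    | nil => rfl
    | append_singleton u a ih =>
      rw [List.map_append, List.map_singleton, ofBlocks_concat, ofBlocks_concat, ih]
      simp only [List.map_append, List.map_cons, List.map_map, List.length_map,
        List.append_cancel_left_eq, List.cons.injEq, true_and, List.map_inj_left]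
      intro x hx
      have := hs _ x hx
      simp
      grind
  nil := rfl
  concat u a := by
    refine ⟨_, ?_, ofBlocks_concat s u a⟩
    intro x hx
    obtain ⟨y, hy, rfl⟩ := List.mem_map.1 hx
    have := hs _ y hy
    rw [List.getD_eq_getElem _ _ (by simp; omega)]
    exact List.getElem_mem _

/-- The fusion lemma for rigid maps. -/
theorem exists_isRigid_fusion (Q : ℕ → (List ℕ → List ℕ) → Prop)
    (hdense : ∀ n F, IsRigid F →
      ∃ X, IsRigid X ∧ (∀ u : List ℕ, u.length < n → X u = u) ∧ Q n (F ∘ X))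
    (hcomp : ∀ n F X, IsRigid F → IsRigid X → (∀ u : List ℕ, u.length < n → X u = u) →
      Q n F → Q n (F ∘ X)) :
    ∃ W, IsRigid W ∧ ∀ N, ∃ F, IsRigid F ∧ (∀ u : List ℕ, u.length < N → W u = F u) ∧
      ∀ n < N, Q n F := by
  choose! X hX hXu hQ using hdense
  let W : ℕ → List ℕ → List ℕ := fun n ↦ Nat.rec id (fun n F ↦ F ∘ X n F) n
  have hW (n) : W (n + 1) = W n ∘ X n (W n) := rfl
  have hWr (n) : IsRigid (W n) := by
    induction n with
    | zero => exact .id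
    | succ n ih => exact ih.comp (hX n _ ih)
  have hWu (u : List ℕ) (n k) (h : u.length < n) : W (n + k) u = W n u := by
    induction k with
    | zero => rfl
    | succ k ih => rw [← add_assoc, hW, Function.comp, hXu _ _ (hWr _) _ (by omega), ih]
  have hWQ (n k) : Q n (W (n + 1 + k)) := by
    induction k with
    | zero => exact hQ n _ (hWr n)
    | succ k ih =>
      rw [← add_assoc, hW]
      exact hcomp _ _ _ (hWr _) (hX _ _ (hWr _)) (fun u hu ↦ hXu _ _ (hWr _) _ (by omega)) ih
  refine ⟨fun u ↦ W (u.length + 1) u, ⟨fun g u ↦ ?_, (hWr 1).nil, fun u a ↦ ?_⟩, fun N ↦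
    ⟨W N, hWr N, fun u hu ↦ ?_, fun n hn ↦ ?_⟩⟩
  · simp [(hWr _).map]
  · simp only [List.length_append, List.length_singleton]
    rw [← hWu u (u.length + 1) 1 (by omega)]
    exact (hWr (u.length + 1 + 1)).concat u a
  · obtain ⟨k, rfl⟩ := Nat.exists_eq_add_of_lt hu
    rw [add_right_comm, hWu _ _ _ (by omega)]
  · obtain ⟨k, rfl⟩ := Nat.exists_eq_add_of_lt hn
    rw [add_right_comm]
    exact hWQ n k

theorem exists_isRigid_append_of_length {κ : Type*} [Finite κ] (c : List ℕ → κ) (K n : ℕ)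
    (F : List ℕ → List ℕ) :
    ∃ X, IsRigid X ∧ (∀ u : List ℕ, u.length < n → X u = u) ∧
      ∀ u z : List ℕ, u.length = n → (∀ x ∈ u, x < K) → z ⊆ u →
        c (F (X (u ++ z))) = c (F (X u)) := by
  rcases n with _ | m
  · refine ⟨id, .id, fun u _ ↦ rfl, fun u z hu _ hz ↦ ?_⟩
    obtain rfl := List.length_eq_zero_iff.1 hu
    simp [List.subset_nil.1 hz]
  let val (g : Fin (m + 1) → Fin K) (y : List (Fin (m + 1))) : List ℕ := y.map fun i ↦ (g i : ℕ)
  obtain ⟨w₀, w, k, h⟩ := exists_appendBlocks_mono (α := Fin (m + 1))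
    fun y ↦ fun g : Fin (m + 1) → Fin K ↦ c (F (val g (List.finRange _) ++ val g y))
  let s (i : ℕ) : List ℕ :=
    if i < m then [] else if i = m then w₀.map Fin.val else
      (w (i - (m + 1))).map fun o ↦ o.elim i Fin.val
  have hs : ∀ i, ∀ x ∈ s i, x ≤ i := by
    intro i x hx
    simp only [s] at hx
    split_ifs at hx with h1 h2
    · simp at hx
    · obtain ⟨y, -, rfl⟩ := List.mem_map.1 hx
      omega
    · obtain ⟨y, -, rfl⟩ := List.mem_map.1 hx
      cases y <;> simp
      omega
  have hX := isRigid_ofBlocks s hs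
  have hXu (u : List ℕ) (hu : u.length < m + 1) : ofBlocks s u = u := by
    induction u using List.reverseRecOn with
    | nil => rfl
    | append_singleton u a ih =>
      simp at hu
      rw [ofBlocks_concat, ih (by omega)]
      simp [s, hu]
  refine ⟨ofBlocks s, hX, hXu, fun u z hu huK hz ↦ ?_⟩
  obtain ⟨g, rfl⟩ : ∃ g, u = val g (List.finRange _) := by
    refine ⟨fun i ↦ ⟨u[i], huK _ (List.getElem_mem _)⟩, ?_⟩
    apply List.ext_getElem <;> simp [val, hu]
  set u := val g (List.finRange (m + 1)) with hudef
  have hget (i : Fin (m + 1)) : u.getD i 0 = g i := by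
    rw [List.getD_eq_getElem _ _ (by omega)]
    simp [hudef, val]
  obtain ⟨y, rfl⟩ : ∃ y, z = val g y := by
    have : z ∈ Set.range (List.map fun i ↦ (g i : ℕ)) := by
      rw [Set.range_list_map]
      intro x hx
      have := hz hx
      simp [hudef, val] at this
      exact this
    obtain ⟨y, hy⟩ := this
    exact ⟨y, hy.symm⟩
  have key (y : List (Fin (m + 1))) :
      ofBlocks s (u ++ val g y) = u ++ val g (appendBlocks w₀ w y.reverse) := by
    induction y using List.reverseRecOn with
    | nil =>
      obtain ⟨v, b, hvb⟩ : ∃ v b, u = v ++ [b] := by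
        rcases List.eq_nil_or_concat u with h | ⟨v, b, h⟩
        · simp [h] at hu
        · exact ⟨v, b, by simpa using h⟩
      have hv : v.length = m := by simpa [hvb] using hu
      simp only [val, List.map_nil, List.append_nil, List.reverse_nil, appendBlocks]
      rw [hvb, ofBlocks_concat, hXu v (by omega), ← hvb]
      simp only [hvb, hv, s, lt_irrefl, if_false, if_true, List.append_assoc, List.singleton_append,
        List.map_map, List.append_cancel_left_eq, List.cons.injEq, true_and]
      rw [← hvb]
      exact List.map_congr_left fun i _ ↦ hget i
    | append_singleton y a ih =>
      have : val g (y ++ [a]) = val g y ++ [(g a : ℕ)] := by simp [val]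
      rw [this, ← List.append_assoc, ofBlocks_concat, ih]
      have hl : (u ++ val g y).length = m + 1 + y.length := by simp [hu, val]
      rw [hl]
      have hsi : s (m + 1 + y.length) =
          (w y.length).map fun o ↦ o.elim (m + 1 + y.length) Fin.val := by
        simp only [s]
        rw [if_neg (by omega), if_neg (by omega), Nat.add_sub_cancel_left]
      rw [hsi]
      simp only [List.reverse_append, List.reverse_singleton, List.singleton_append, appendBlocks,
        List.length_reverse, val, List.map_append, List.map_cons, List.map_map, List.append_assoc,
        List.append_cancel_left_eq, List.cons.injEq, true_and]
      apply List.map_congr_left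
      rintro (_ | i) -
      · have : ¬ m + 1 + y.length ≤ m := by omega
        simp [hu, List.getElem?_append, this]
      · have := hget i
        have hi : (i : ℕ) < u.length := by omega
        simp [List.getElem?_append, hi] at this ⊢
        exact this
  have h1 := congrFun ((h y.reverse).trans (h [].reverse).symm) g
  simp only [← hudef, ← key] at h1
  simpa [val] using h1

theorem exists_isRigid_append {κ : Type*} [Finite κ] (c : List ℕ → κ) (K : ℕ) :
    ∃ W, IsRigid W ∧ ∀ u z : List ℕ, (∀ x ∈ u, x < K) → z ⊆ u → c (W (u ++ z)) = c (W u) := by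
  obtain ⟨W, hW, h⟩ := exists_isRigid_fusion
    (fun n F ↦ ∀ u z : List ℕ, u.length = n → (∀ x ∈ u, x < K) → z ⊆ u →
      c (F (u ++ z)) = c (F u))
    (fun n F _ ↦ exists_isRigid_append_of_length c K n F) <| by
      intro n F X hF hX hXu hQ u z hu huK hz
      obtain ⟨y, hy, h⟩ : ∃ y ⊆ u, X u = u ++ y := by
        rcases List.eq_nil_or_concat u with rfl | ⟨v, b, rfl⟩
        · exact ⟨[], by simp, hX.nil⟩
        · rw [List.concat_eq_append] at *
          obtain ⟨y, hy, h⟩ := hX.concat v b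
          exact ⟨y, hy, by rw [h, hXu v (by simp at hu; omega)]; simp⟩
      obtain ⟨y', hy', h'⟩ := hX.append u z
      have hy'u : y' ⊆ u := List.Subset.trans hy' (List.append_subset.2 ⟨List.Subset.refl u, hz⟩)
      simp only [Function.comp, h', h, List.append_assoc]
      rw [hQ u (y ++ y') hu huK (List.append_subset.2 ⟨hy, hy'u⟩), hQ u y hu huK hy]
  refine ⟨W, hW, fun u z huK hz ↦ ?_⟩
  obtain ⟨F, -, hWF, hQ⟩ := h ((u ++ z).length + 1)
  rw [hWF _ (by simp), hWF u (by simp)]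
  exact hQ u.length (by simp) u z rfl huK hz

/-- `RestrictedGrowth k u` says that `u` is a restricted growth string with letters `0, …, k - 1`:
each of these occurs and their first occurrences are in increasing order. -/
def RestrictedGrowth : ℕ → List ℕ → Prop
  | 0, u => u = []
  | k + 1, u => ∃ v z, RestrictedGrowth k v ∧ u = v ++ k :: z ∧ ∀ x ∈ z, x < k + 1

namespace RestrictedGrowth

theorem lt {k : ℕ} {u : List ℕ} (h : RestrictedGrowth k u) : ∀ x ∈ u, x < k := by
  induction k generalizing u with
  | zero => simp [show u = [] from h]
  | succ k ih =>
    obtain ⟨v, z, hv, rfl, hz⟩ := h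
    have := ih hv
    simp only [List.mem_append, List.mem_cons]
    rintro x (hx | rfl | hx)
    · exact (this x hx).trans (Nat.lt_succ_self k)
    · exact Nat.lt_succ_self _
    · exact hz x hx

theorem mem {k : ℕ} {u : List ℕ} (h : RestrictedGrowth k u) : ∀ x < k, x ∈ u := by
  induction k generalizing u with
  | zero => simp
  | succ k ih =>
    obtain ⟨v, z, hv, rfl, hz⟩ := h
    intro x hx
    rcases Nat.lt_succ_iff_lt_or_eq.1 hx with hx | rfl
    · simp [ih hv x hx]
    · simp

theorem concat_of_lt {k : ℕ} {u : List ℕ} (h : RestrictedGrowth k u) {a : ℕ} (ha : a < k) :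
    RestrictedGrowth k (u ++ [a]) := by
  obtain _ | k := k
  · omega
  · obtain ⟨v, z, hv, rfl, hz⟩ := h
    refine ⟨v, z ++ [a], hv, by simp, fun x hx ↦ ?_⟩
    rcases List.mem_append.1 hx with hx | hx
    · exact hz x hx
    · simpa [List.mem_singleton.1 hx] using ha

theorem concat_self {k : ℕ} {u : List ℕ} (h : RestrictedGrowth k u) :
    RestrictedGrowth (k + 1) (u ++ [k]) :=
  ⟨u, [], h, rfl, by simp⟩

theorem exists_append {k K : ℕ} {u : List ℕ} (h : RestrictedGrowth k u) (hk : k ≤ K) :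
    ∃ z, RestrictedGrowth K (u ++ z) := by
  induction K, hk using Nat.le_induction with
  | base => exact ⟨[], by simpa⟩
  | succ K _ ih =>
    obtain ⟨z, hz⟩ := ih
    exact ⟨z ++ [K], by simpa using hz.concat_self⟩

theorem exists_eq_append_cons {k i : ℕ} {u : List ℕ} (h : RestrictedGrowth k u) (hi : i < k) :
    ∃ v z, (∀ x ∈ v, x < i) ∧ u = v ++ i :: z := by
  induction k generalizing u with
  | zero => omega
  | succ k ih =>
    obtain ⟨v, z, hv, rfl, hz⟩ := h
    rcases Nat.lt_succ_iff_lt_or_eq.1 hi with hi | rfl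
    · obtain ⟨v', z', hv', rfl⟩ := ih hv hi
      exact ⟨v', z' ++ k :: z, hv', by simp⟩
    · exact ⟨v, z, hv.lt, rfl⟩

theorem map_isRigid {F : List ℕ → List ℕ} (hF : IsRigid F) {k : ℕ} {u : List ℕ}
    (h : RestrictedGrowth k u) : RestrictedGrowth k (F u) := by
  induction k generalizing u with
  | zero =>
    obtain rfl : u = [] := h
    exact hF.nil
  | succ k ih =>
    have hlt := h.lt
    obtain ⟨v, z, hv, rfl, -⟩ := h
    obtain ⟨y, hy, h'⟩ := hF.append_cons v z k
    exact ⟨F v, y, ih hv, h', fun x hx ↦ hlt x (hy hx)⟩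

end RestrictedGrowth

/-- The Carlson–Simpson theorem for finite colorings of restricted growth strings. -/
theorem exists_isRigid_mono (k : ℕ) {κ : Type*} [Finite κ] (c : List ℕ → κ) :
    ∃ W, IsRigid W ∧ ∃ a, ∀ u, RestrictedGrowth k u → c (W u) = a := by
  induction k generalizing c with
  | zero =>
    refine ⟨id, .id, c [], ?_⟩
    rintro u rfl
    rfl
  | succ k ih =>
    obtain ⟨W, hW, h⟩ := exists_isRigid_append c (k + 1)
    obtain ⟨X, hX, a, hX'⟩ := ih fun v ↦ c (W (v ++ [k]))
    refine ⟨W ∘ X, hW.comp hX, a, fun u hu ↦ ?_⟩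
    have hu' := hu.map_isRigid hX
    obtain ⟨v, z, hv, rfl, hz⟩ := hu
    obtain ⟨y, hy, hXy⟩ := hX.append_cons v z k
    have hv' := hv.map_isRigid hX
    rw [hXy] at hu'
    have hlt := hu'.lt
    have := h (X v ++ [k]) y (fun x hx ↦ hlt x (by simp at hx ⊢; tauto)) (by
      intro x hx
      rcases Nat.lt_succ_iff_lt_or_eq.1 (hlt x (by simp [hx])) with h | rfl
      · simp [hv'.mem x h]
      · simp)
    simp only [Function.comp, hXy]
    rw [← hX' v hv, ← this]
    simp

/-- The substitution of the word `s` into the finite parameter word `u`, truncated at the first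
parameter that does not occur in `s`. -/
def substTrunc (u s : List ℕ) : List ℕ :=
  (u.takeWhile (· < s.length)).map (s.getD · 0)

theorem substTrunc_append_cons {v s : List ℕ} (z : List ℕ) (h : ∀ x ∈ v, x < s.length) :
    substTrunc (v ++ s.length :: z) s = v.map (s.getD · 0) := by
  unfold substTrunc
  rw [List.takeWhile_append_of_pos (by simpa using h)]
  simp

theorem IsRigid.substTrunc {F : List ℕ → List ℕ} (hF : IsRigid F) {k : ℕ} {u s : List ℕ}
    (hu : RestrictedGrowth k u) (hs : s.length < k) :
    F (substTrunc u s) = substTrunc (F u) s := by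
  obtain ⟨v, z, hv, rfl⟩ := hu.exists_eq_append_cons hs
  obtain ⟨y, -, hy⟩ := hF.append_cons v z s.length
  rw [substTrunc_append_cons z hv, hy,
    substTrunc_append_cons y fun x hx ↦ hv x (hF.subset v hx), hF.map]

theorem exists_restrictedGrowth_map {κ : Type*} [Fintype κ] (l : List κ) :
    ∃ (f : κ → ℕ) (k : ℕ), k ≤ Fintype.card κ ∧ RestrictedGrowth k (l.map f) ∧
      Set.InjOn f {x | x ∈ l} := by
  classical
  suffices h : ∃ (f : κ → ℕ) (k : ℕ), RestrictedGrowth k (l.map f) ∧ Set.InjOn f {x | x ∈ l} by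
    obtain ⟨f, k, hk, hf⟩ := h
    refine ⟨f, k, ?_, hk, hf⟩
    have : Finset.range k ⊆ Finset.univ.image f := by
      intro x hx
      obtain ⟨y, -, rfl⟩ := List.mem_map.1 (hk.mem x (Finset.mem_range.1 hx))
      simp
    simpa using (Finset.card_le_card this).trans Finset.card_image_le
  induction l using List.reverseRecOn with
  | nil => exact ⟨fun _ ↦ 0, 0, rfl, by simp⟩
  | append_singleton l a ih =>
    obtain ⟨f, k, hk, hf⟩ := ih
    by_cases ha : a ∈ l
    · refine ⟨f, k, ?_, ?_⟩
      · rw [List.map_append, List.map_singleton]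
        exact hk.concat_of_lt (hk.lt _ (List.mem_map_of_mem ha))
      · convert hf using 1
        ext x
        simp
        rintro rfl
        exact ha
    · have hne : ∀ x ∈ l, x ≠ a := fun x hx h ↦ ha (h ▸ hx)
      refine ⟨Function.update f a k, k + 1, ?_, ?_⟩
      · have : l.map (Function.update f a k) = l.map f :=
          List.map_congr_left fun x hx ↦ Function.update_of_ne (hne x hx) _ _
        rw [List.map_append, List.map_singleton, this, Function.update_self]
        exact hk.concat_self
      · have hlt : ∀ x ∈ l, f x < k := fun x hx ↦ hk.lt _ (List.mem_map_of_mem hx)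
        intro x hx y hy hxy
        simp at hx hy
        rcases hx with hx | rfl <;> rcases hy with hy | rfl
        · rw [Function.update_of_ne (hne x hx), Function.update_of_ne (hne y hy)] at hxy
          exact hf hx hy hxy
        · rw [Function.update_of_ne (hne x hx), Function.update_self] at hxy
          exact absurd hxy (hlt x hx).ne
        · rw [Function.update_of_ne (hne y hy), Function.update_self] at hxy
          exact absurd hxy (hlt y hy).ne'
        · rfl

/-- Envelopes: finitely many binary words are simultaneously obtained by substitution of short
binary words into a single parameter word. -/
theorem exists_envelope {ι : Type*} [Fintype ι] (s : ι → List ℕ) (hs : ∀ i, ∀ x ∈ s i, x < 2)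
    (K : ℕ) (hK : 2 ^ Fintype.card ι + Fintype.card ι < K) :
    ∃ u, RestrictedGrowth K u ∧ ∃ t : ι → List ℕ,
      ∀ i, (t i).length < K ∧ (∀ x ∈ t i, x < 2) ∧ s i = substTrunc u (t i) := by
  classical
  have hs' (i j) : (s i).getD j 0 < 2 := by
    by_cases h : j < (s i).length
    · rw [List.getD_eq_getElem _ _ h]
      exact hs i _ (List.getElem_mem _)
    · rw [List.getD_eq_default _ _ (by omega)]
      omega
  let key (j : ℕ) : (ι → Fin 2) ⊕ ι :=
    if h : ∃ i, (s i).length = j then .inr h.choose else .inl fun i ↦ ⟨(s i).getD j 0, hs' i j⟩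
  have hkey {i : ι} {j : ℕ} (h : key j = key (s i).length) : j = (s i).length := by
    have h1 : ∃ i', (s i').length = (s i).length := ⟨i, rfl⟩
    simp only [key, dif_pos h1] at h
    split_ifs at h with h2
    · rw [← h2.choose_spec, Sum.inr_injective h, h1.choose_spec]
  have hkey' {j j' : ℕ} (h : key j = key j') (i : ι) : (s i).getD j 0 = (s i).getD j' 0 := by
    by_cases h1 : ∃ i, (s i).length = j
    · obtain ⟨i, rfl⟩ := h1
      rw [hkey h.symm]
    · by_cases h2 : ∃ i, (s i).length = j'
      · obtain ⟨i, rfl⟩ := h2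
        rw [hkey h]
      · simp only [key, dif_neg h1, dif_neg h2] at h
        have := congrFun (Sum.inl_injective h) i
        simpa using this
  obtain ⟨N, hN⟩ : ∃ N, ∀ i, (s i).length < N :=
    ⟨(Finset.univ.sup fun i ↦ (s i).length) + 1, fun i ↦ Nat.lt_succ_of_le
      (Finset.le_sup (f := fun i ↦ (s i).length) (Finset.mem_univ i))⟩
  obtain ⟨f, k, hk, hu, hf⟩ := exists_restrictedGrowth_map ((List.range N).map key)
  have hf' {j j' : ℕ} (hj : j < N) (hj' : j' < N) (h : f (key j) = f (key j')) :
      key j = key j' := hf (by simp; exact ⟨j, hj, rfl⟩) (by simp; exact ⟨j', hj', rfl⟩) h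
  have hkK : k < K := by simp at hk; omega
  obtain ⟨z, hz⟩ := hu.exists_append hkK.le
  refine ⟨_, hz, fun i ↦ (List.range (f (key (s i).length))).map fun l ↦
    if h : ∃ j < (s i).length, f (key j) = l then (s i).getD h.choose 0 else 0, fun i ↦ ?_⟩
  set m := (s i).length with hm
  have hmk : f (key m) < k := hu.lt _ (List.mem_map_of_mem
    (List.mem_map_of_mem (List.mem_range.2 (hN i))))
  refine ⟨by simpa using hmk.trans hkK, ?_, ?_⟩
  · simp only [List.mem_map]
    rintro x ⟨l, -, rfl⟩
    split_ifs
    · exact hs' _ _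
    · omega
  · set t := (List.range (f (key m))).map fun l ↦
      if h : ∃ j < m, f (key j) = l then (s i).getD h.choose 0 else 0 with ht
    have htl : t.length = f (key m) := by simp [ht]
    obtain ⟨y, hy⟩ : ∃ y, ((List.range N).map key).map f ++ z =
        (List.range m).map (f ∘ key) ++ t.length :: y := by
      obtain ⟨d, rfl⟩ := Nat.exists_eq_add_of_lt (hN i)
      rw [← hm, htl, add_assoc, List.range_add, List.range_succ_eq_map]
      simp
    have hlt : ∀ x ∈ (List.range m).map (f ∘ key), x < t.length := by
      obtain ⟨v, w, hv, hvw⟩ := hz.exists_eq_append_cons (i := t.length) (by omega)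
      have hnot : t.length ∉ (List.range m).map (f ∘ key) := by
        rw [htl]
        simp only [List.mem_map, List.mem_range, not_exists, not_and, Function.comp]
        intro j hj h
        have := hkey (hf' (hj.trans (hN i)) (hN i) h)
        omega
      have hnot' : t.length ∉ v := fun h ↦ (hv _ h).false
      rw [hy] at hvw
      have : (List.range m).map (f ∘ key) = v := by
        have h1 := congrArg (List.takeWhile (· ≠ t.length)) hvw
        rwa [List.takeWhile_append_of_pos, List.takeWhile_append_of_pos,
          List.takeWhile_cons_of_neg, List.takeWhile_cons_of_neg, List.append_nil,
          List.append_nil] at h1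
        · simp
        · simp
        · intro x hx
          simpa using ne_of_mem_of_not_mem hx hnot'
        · intro x hx
          simpa only [ne_eq, decide_not, Bool.not_eq_eq_eq_not, Bool.not_true,
            decide_eq_false_iff_not] using ne_of_mem_of_not_mem hx hnot
      rwa [this]
    rw [hy, substTrunc_append_cons y hlt]
    apply List.ext_getElem
    · simp [hm]
    · intro j hj _
      have hlj := hlt (f (key j)) (List.mem_map_of_mem (f := f ∘ key) (List.mem_range.2 hj))
      have hex : ∃ j' < m, f (key j') = f (key j) := ⟨j, hj, rfl⟩
      have h1 : key hex.choose = key j :=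
        hf' (hex.choose_spec.1.trans (hN i)) (hj.trans (hN i)) hex.choose_spec.2
      have h2 := hkey' h1 i
      simp only [List.getElem_map, List.getElem_range, Function.comp]
      rw [List.getD_eq_getElem _ _ hlj]
      simp only [ht, List.getElem_map, List.getElem_range]
      rw [dif_pos hex, h2, List.getD_eq_getElem _ _ hj]

theorem ExtensionProperty.exists_embedding {V A : Type} [Countable A] {R : SimpleGraph V}
    (hR : ExtensionProperty R) (T : SimpleGraph A) : Nonempty (T ↪g R) := by
  classical
  obtain ⟨enc, henc⟩ := exists_injective_nat A
  suffices h : ∀ H : SimpleGraph ℕ, Nonempty (H ↪g R) from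
    (h (T.map enc)).map fun f ↦ f.comp (SimpleGraph.Embedding.map ⟨enc, henc⟩ T)
  intro H
  have : Nonempty V := ⟨(hR ∅ ∅ (by simp)).choose⟩
  choose! nxt hU hW hUadj hWadj using hR
  let U (n : ℕ) (p : ℕ → V) : Finset V := ((Finset.range n).filter (H.Adj n)).image p
  let W (n : ℕ) (p : ℕ → V) : Finset V := ((Finset.range n).filter (¬ H.Adj n ·)).image p
  let v₀ : V := Classical.arbitrary V
  let p : ℕ → ℕ → V := fun n ↦ Nat.rec (fun _ ↦ v₀)
    (fun n p ↦ Function.update p n (nxt (U n p) (W n p))) n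
  have hp (n) : p (n + 1) = Function.update (p n) n (nxt (U n (p n)) (W n (p n))) := rfl
  let f (n : ℕ) : V := p (n + 1) n
  have hf (n) : f n = nxt (U n f) (W n f) := by
    have hpf (m) : ∀ i < m, p m i = f i := by
      induction m with
      | zero => simp
      | succ m ih =>
        intro i hi
        rcases Nat.lt_succ_iff_lt_or_eq.1 hi with hi | rfl
        · rw [hp, Function.update_of_ne hi.ne, ih i hi]
        · rfl
    have hUf : U n (p n) = U n f :=
      Finset.image_congr fun i hi ↦ hpf n i (by simp at hi; exact hi.1)
    have hWf : W n (p n) = W n f :=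
      Finset.image_congr fun i hi ↦ hpf n i (by simp at hi; exact hi.1)
    simp only [f]
    rw [hp, Function.update_self, hUf, hWf]
  have key (n) : (∀ i < n, f i ≠ f n) ∧ ∀ i < n, R.Adj (f n) (f i) ↔ H.Adj n i := by
    induction n using Nat.strong_induction_on with
    | _ n ih =>
      have hinj : ∀ i < n, ∀ j < n, f i = f j → i = j := by
        intro i hi j hj hij
        rcases lt_trichotomy i j with h | h | h
        · exact absurd hij ((ih j hj).1 i h)
        · exact h
        · exact absurd hij.symm ((ih i hi).1 j h)
      have hdisj : Disjoint (U n f) (W n f) := by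
        rw [Finset.disjoint_left]
        intro x hx hx'
        simp only [U, W, Finset.mem_image, Finset.mem_filter, Finset.mem_range] at hx hx'
        obtain ⟨i, ⟨hi, hi'⟩, rfl⟩ := hx
        obtain ⟨j, ⟨hj, hj'⟩, hij⟩ := hx'
        exact hj' (hinj j hj i hi hij ▸ hi')
      have memU {i} (hi : i < n) (h : H.Adj n i) : f i ∈ U n f :=
        Finset.mem_image_of_mem _ (by simp [hi, h])
      have memW {i} (hi : i < n) (h : ¬ H.Adj n i) : f i ∈ W n f :=
        Finset.mem_image_of_mem _ (by simp [hi, h])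
      refine ⟨fun i hi h ↦ ?_, fun i hi ↦ ?_⟩
      · rw [hf n] at h
        by_cases hadj : H.Adj n i
        · exact hU _ _ hdisj (h ▸ memU hi hadj)
        · exact hW _ _ hdisj (h ▸ memW hi hadj)
      · rw [hf n]
        by_cases hadj : H.Adj n i
        · simp [hadj, hUadj _ _ hdisj _ (memU hi hadj)]
        · simp [hadj, hWadj _ _ hdisj _ (memW hi hadj)]
  refine ⟨⟨⟨f, fun i j hij ↦ ?_⟩, fun {i j} ↦ ?_⟩⟩
  · rcases lt_trichotomy i j with h | h | h
    · exact absurd hij ((key j).1 i h)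
    · exact h
    · exact absurd hij.symm ((key i).1 j h)
  · change R.Adj (f i) (f j) ↔ H.Adj i j
    rcases lt_trichotomy i j with h | rfl | h
    · rw [R.adj_comm, H.adj_comm, (key j).2 i h]
    · simp
    · exact (key i).2 j h

theorem ExtensionProperty.infinite {V : Type} {R : SimpleGraph V} (hR : ExtensionProperty R) :
    Infinite V := by
  by_contra h
  rw [not_infinite_iff_finite] at h
  have := Fintype.ofFinite V
  obtain ⟨v, hv, -⟩ := hR Finset.univ ∅ (by simp)
  simp at hv

/-- The graph on finite words where a word `u` is adjacent to a longer word `v` if the letter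
of `v` at position `u.length` is `1`. -/
def wordGraph : SimpleGraph (List ℕ) where
  Adj u v := u.length < v.length ∧ v[u.length]? = some 1 ∨
    v.length < u.length ∧ u[v.length]? = some 1
  symm := ⟨fun _ _ ↦ Or.symm⟩
  loopless := ⟨fun u h ↦ by simp at h⟩

theorem wordGraph_adj_of_lt {u v : List ℕ} (h : u.length < v.length) :
    wordGraph.Adj u v ↔ v[u.length]? = some 1 := by
  simp [wordGraph, h, h.not_gt]

theorem not_wordGraph_adj_of_length_eq {u v : List ℕ} (h : u.length = v.length) :
    ¬ wordGraph.Adj u v := by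
  simp [wordGraph, h]

/-- A rigid map is a self-embedding of the graph on words. -/
def IsRigid.embedding {F : List ℕ → List ℕ} (hF : IsRigid F) : wordGraph ↪g wordGraph where
  toFun := F
  inj' := hF.injective
  map_rel_iff' {u v} := by
    change wordGraph.Adj (F u) (F v) ↔ wordGraph.Adj u v
    have key {u v : List ℕ} (h : u.length < v.length) :
        wordGraph.Adj (F u) (F v) ↔ wordGraph.Adj u v := by
      rw [wordGraph_adj_of_lt h, wordGraph_adj_of_lt (hF.getElem?_length h).1,
        (hF.getElem?_length h).2]
    rcases lt_trichotomy u.length v.length with h | h | h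
    · exact key h
    · simp only [not_wordGraph_adj_of_length_eq h,
        not_wordGraph_adj_of_length_eq (hF.length_congr h)]
    · rw [wordGraph.adj_comm, key h, wordGraph.adj_comm]

theorem exists_embedding_wordGraph {V : Type} [Countable V] [Infinite V] (R : SimpleGraph V) :
    ∃ f : R ↪g wordGraph, ∀ v, ∀ x ∈ f v, x < 2 := by
  classical
  obtain ⟨e⟩ : Nonempty (V ≃ ℕ) := nonempty_equiv_of_countable
  let t (v : V) : List ℕ := (List.range (e v)).map fun j ↦ if R.Adj v (e.symm j) then 1 else 0
  have hl (v) : (t v).length = e v := by simp [t]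
  have key {u v : V} (h : e u < e v) : wordGraph.Adj (t u) (t v) ↔ R.Adj u v := by
    rw [wordGraph_adj_of_lt (by simpa [hl] using h), hl, R.adj_comm]
    simp [t, h]
  refine ⟨⟨⟨t, fun u v h ↦ e.injective (by rw [← hl, h, hl])⟩, fun {u v} ↦ ?_⟩, fun v x hx ↦ ?_⟩
  · change wordGraph.Adj (t u) (t v) ↔ R.Adj u v
    rcases lt_trichotomy (e u) (e v) with h | h | h
    · exact key h
    · simp [e.injective h]
    · rw [wordGraph.adj_comm, key h, R.adj_comm]
  · obtain ⟨j, -, rfl⟩ := List.mem_map.1 hx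
    split_ifs <;> omega

/-- **Sauer.** The Rado graph has finite big Ramsey degrees: for every finite graph `G` there
is a positive integer `n` such that for every Rado graph `R` and every coloring of the
induced copies of `G` in `R` into finitely many colors, there is an induced subgraph of `R`
isomorphic to `R` in which the copies of `G` take at most `n` colors. -/
theorem rado_finite_big_ramsey_degrees {W : Type} [Fintype W] (G : SimpleGraph W) :
    ∃ n : ℕ, 0 < n ∧
      ∀ (V : Type) [Countable V] (R : SimpleGraph V), ExtensionProperty R →
        ∀ (k : ℕ) (c : Set V → Fin (k + 1)),
          ∃ V' : Set V, Nonempty (R ≃g R.induce V') ∧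
            ∃ colors : Finset (Fin (k + 1)), colors.card ≤ n ∧
              ∀ S : Set V, S ⊆ V' → Nonempty (G ≃g R.induce S) → c S ∈ colors := by
  classical
  let K := 2 ^ Fintype.card W + Fintype.card W + 1
  let P : Set (List ℕ) := {l | l.length < K ∧ ∀ x ∈ l, x < 2}
  have hP : P.Finite := by
    refine ((List.finite_length_lt (Fin 2) K).image (List.map Fin.val)).subset ?_
    rintro l ⟨hl, hl2⟩
    have : l ∈ Set.range (List.map (Fin.val : Fin 2 → ℕ)) := by
      rw [Set.range_list_map]
      exact fun x hx ↦ ⟨⟨x, hl2 x hx⟩, rfl⟩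
    obtain ⟨y, rfl⟩ := this
    exact ⟨y, by simpa using hl, rfl⟩
  have := hP.fintype
  have : Nonempty P := ⟨⟨[], by simp [P, K]⟩⟩
  refine ⟨Fintype.card (W → P), Fintype.card_pos, fun V _ R hR k c ↦ ?_⟩
  have := hR.infinite
  obtain ⟨t, ht⟩ := exists_embedding_wordGraph R
  obtain ⟨g⟩ := hR.exists_embedding wordGraph
  obtain ⟨F, hF, a, ha⟩ := exists_isRigid_mono K fun u ↦ fun q : W → P ↦
    c (Set.range fun w ↦ g (substTrunc u (q w)))
  let h : R ↪g R := (g.comp hF.embedding).comp t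
  refine ⟨Set.range h, ⟨h.isoInduceRange⟩,
    Finset.univ.image a, Finset.card_image_le, ?_⟩
  rintro S hS ⟨φ⟩
  choose b hb using fun w ↦ hS (φ w).2
  obtain ⟨u, hu, q, hq⟩ := exists_envelope (fun w ↦ t (b w)) (fun w ↦ ht (b w)) K
    (Nat.lt_succ_self _)
  have hS' : S = Set.range fun w ↦ g (substTrunc (F u) (q w)) := by
    have (w : W) : g (substTrunc (F u) (q w)) = φ w := by
      rw [← hF.substTrunc hu (hq w).1, ← (hq w).2.2, ← hb w]
      rfl
    simp only [this]
    ext x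
    refine ⟨fun hx ↦ ⟨φ.symm ⟨x, hx⟩, by simp⟩, ?_⟩
    rintro ⟨w, rfl⟩
    exact (φ w).2
  have := congrFun (ha u hu) fun w ↦ ⟨q w, (hq w).1, (hq w).2.1⟩
  rw [hS', this]
  exact Finset.mem_image_of_mem _ (Finset.mem_univ _)
end

section
/- (Devlin) For each positive integer d there is a positive integer t_d such that: (a) for every coloring of the d-element subsets of ℚ into finitely many colors, there is a subset Q' ⊆ ℚ order-isomorphic to ℚ such that the d-element subsets of Q' take at most t_d colors; and (b) there is a coloring of the d-element subsets of ℚ into exactly t_d colors such that for every subset Q' ⊆ ℚ order-isomorphic to ℚ, all t_d colors occur on d-element subsets of Q'. -/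
section Ultrafilters

open Filter

attribute [local instance] Ultrafilter.semigroup

/-- A compact right topological semigroup contains a point generating a minimal left ideal. -/
theorem exists_mem_forall_exists_mul_mul_eq {M : Type*} [Semigroup M] [TopologicalSpace M]
    [T2Space M] [CompactSpace M] (hcont : ∀ r : M, Continuous (· * r)) (C : Set M)
    (hC : IsClosed C) (hne : C.Nonempty) (hmul : ∀ x ∈ C, ∀ y ∈ C, x * y ∈ C) :
    ∃ p ∈ C, ∀ s ∈ C, ∃ s' ∈ C, s' * (s * p) = p := by
  let S : Set (Set M) :=
    {N | IsClosed N ∧ N.Nonempty ∧ N ⊆ C ∧ ∀ s ∈ C, ∀ n ∈ N, s * n ∈ N}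
  obtain ⟨N, hN⟩ : ∃ N, Minimal (· ∈ S) N := by
    obtain ⟨N, -, hN⟩ := zorn_superset_nonempty S (fun c hcs hc hcne => by
      refine ⟨⋂₀ c, ⟨isClosed_sInter fun t ht => (hcs ht).1, ?_, ?_, ?_⟩, fun s hs =>
        Set.sInter_subset_of_mem hs⟩
      · have := hcne.coe_sort
        rw [Set.sInter_eq_iInter]
        exact IsCompact.nonempty_iInter_of_directed_nonempty_isCompact_isClosed _
          (DirectedOn.directed_val (IsChain.directedOn hc.symm))
          (fun i => (hcs i.prop).2.1) (fun i => (hcs i.prop).1.isCompact)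
          (fun i => (hcs i.prop).1)
      · obtain ⟨t, ht⟩ := hcne
        exact (Set.sInter_subset_of_mem ht).trans (hcs ht).2.2.1
      · exact fun s hs n hn t ht => (hcs ht).2.2.2 s hs n (hn t ht))
      C ⟨hC, hne, subset_rfl, hmul⟩
    exact ⟨N, hN⟩
  obtain ⟨hNc, ⟨p, hp⟩, hNC, hNl⟩ := hN.prop
  refine ⟨p, hNC hp, fun s hs => ?_⟩
  have himage : (· * (s * p)) '' C = N := by
    apply hN.eq_of_subset
    · refine ⟨(hcont _).isClosedMap _ hC, hne.image _, ?_, ?_⟩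
      · rintro _ ⟨x, hx, rfl⟩
        exact hmul _ hx _ (hmul _ hs _ (hNC hp))
      · rintro t ht _ ⟨x, hx, rfl⟩
        exact ⟨t * x, hmul _ ht _ hx, mul_assoc _ _ _⟩
    · rintro _ ⟨x, hx, rfl⟩
      exact hNl _ hx _ (hNl _ hs _ hp)
  rw [← himage] at hp
  obtain ⟨s', hs', h⟩ := hp
  exact ⟨s', hs', h⟩

theorem Ultrafilter.map_mul_mulHom {T : Type*} [Semigroup T] (θ : T →ₙ* T) (u v : Ultrafilter T) :
    (u * v).map θ = u.map θ * v.map θ := by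
  refine Ultrafilter.coe_inj.mp (Filter.ext' fun P => ?_)
  simp [Ultrafilter.eventually_mul]

/-- The ultrafilter form of the Carlson–Simpson theorem, for an abstract semigroup `T` of variable
words, its subsemigroup `S` of constant words, its right ideal `L` of left variable words and the
substitutions `θ a`. -/
theorem exists_mono_closed_under_substitution {T ι κ : Type*} [Semigroup T] [Finite ι] [Finite κ]
    (S L : Set T) (hS : S.Nonempty) (hSmul : ∀ x ∈ S, ∀ y ∈ S, x * y ∈ S)
    (hL : L.Nonempty) (hLmul : ∀ x ∈ L, ∀ y, x * y ∈ L)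
    (θ : ι → T →ₙ* T) (hθS : ∀ a x, θ a x ∈ S) (hθ : ∀ a, ∀ x ∈ S, θ a x = x) (c : T → κ) :
    ∃ B : Set T, (∃ w ∈ B, w ∈ S) ∧ (∀ x ∈ B, ∀ y ∈ B, c x = c y) ∧
      ∀ F : Finset T, ↑F ⊆ B → ∃ t ∈ L, ∀ w ∈ F, ∀ a, w * θ a t ∈ B := by
  obtain ⟨p, hpS, hp⟩ := exists_mem_forall_exists_mul_mul_eq
    (Ultrafilter.continuous_mul_left (M := T)) {u | S ∈ u} (ultrafilter_isClosed_basic S)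
    (by obtain ⟨x, hx⟩ := hS; exact ⟨pure x, hx⟩)
    (fun u hu v hv => by
      change ∀ᶠ x in (↑(u * v) : Filter T), x ∈ S
      rw [Ultrafilter.eventually_mul]
      filter_upwards [hu] with x hx
      filter_upwards [hv] with y hy using hSmul x hx y hy)
  have hLu : ∀ u v : Ultrafilter T, L ∈ u → L ∈ u * v := fun u v hu => by
    change ∀ᶠ x in (↑(u * v) : Filter T), x ∈ L
    rw [Ultrafilter.eventually_mul]
    filter_upwards [hu] with x hx
    exact Eventually.of_forall fun y => hLmul x hx y
  obtain ⟨r, ⟨s, hs, rfl⟩, hr⟩ := exists_idempotent_in_compact_subsemigroup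
    (Ultrafilter.continuous_mul_left (M := T)) ((· * p) '' {u | L ∈ u})
    (by obtain ⟨x, hx⟩ := hL; exact Set.Nonempty.image _ ⟨pure x, hx⟩)
    ((ultrafilter_isClosed_basic L).isCompact.image (Ultrafilter.continuous_mul_left p))
    (by
      rintro _ ⟨u, hu, rfl⟩ _ ⟨v, hv, rfl⟩
      exact ⟨u * p * v, hLu _ _ (hLu _ _ hu), mul_assoc _ _ _⟩)
  simp only at hr
  set r := s * p with hrdef
  have hrL : L ∈ r := hLu _ _ hs
  have hmap : ∀ a, r.map (θ a) = s.map (θ a) * p := fun a => by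
    rw [hrdef, Ultrafilter.map_mul_mulHom]
    congr 1
    refine Ultrafilter.coe_inj.mp ?_
    rw [Ultrafilter.coe_map, Filter.map_congr (m₂ := id), Filter.map_id]
    filter_upwards [hpS] with x hx using hθ a x hx
  have hidem : ∀ a, r.map (θ a) * r.map (θ a) = r.map (θ a) := fun a => by
    rw [← Ultrafilter.map_mul_mulHom, hr]
  have habs : ∀ a, p * r.map (θ a) = p := fun a => by
    obtain ⟨s', -, h⟩ := hp (s.map (θ a)) (Eventually.of_forall fun x => hθS a x)
    rw [← hmap] at h
    nth_rw 1 [← h]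
    rw [mul_assoc, hidem, h]
  have hmul : ∀ a b, r.map (θ a) * r.map (θ b) = r.map (θ a) := fun a b => by
    rw [hmap a, mul_assoc, habs]
  obtain ⟨color, hcolor⟩ := (p.map c).eq_pure_of_finite
  have hA : ∀ᶠ x in (p : Filter T), c x = color := by
    have : ({color} : Set κ) ∈ p.map c := by rw [hcolor]; exact rfl
    exact this
  let B : Set T := {w | c w = color ∧ ∀ a, ∀ᶠ t in (r : Filter T), c (w * θ a t) = color}
  refine ⟨B, ?_, fun x hx y hy => hx.1.trans hy.1.symm, fun F hF => ?_⟩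
  · have hB : ∀ᶠ w in (p : Filter T), w ∈ B := by
      refine hA.and (eventually_all.2 fun a => ?_)
      rw [← habs a, Ultrafilter.eventually_mul] at hA
      exact hA
    obtain ⟨w, hw⟩ := (hB.and hpS).exists
    exact ⟨w, hw⟩
  · have hstep : ∀ w ∈ F, ∀ a, ∀ᶠ t in (r : Filter T), w * θ a t ∈ B := fun w hw a => by
      refine ((hF hw).2 a).and (eventually_all.2 fun b => ?_)
      have h : ∀ᶠ x in (↑(r.map (θ a)) : Filter T), c (w * x) = color := (hF hw).2 a
      rw [← hmul a b, Ultrafilter.eventually_mul] at h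
      simp only [← mul_assoc] at h
      exact h
    obtain ⟨t, ht, h⟩ := (((eventually_all_finset F).2 fun w hw =>
      eventually_all.2 (hstep w hw)).and hrL).exists
    exact ⟨t, h, ht⟩

end Ultrafilters

/-- `IsParamMap m F` says that `F` is the substitution map `U ↦ W[U]` of an infinite parameter word
`W` over the alphabet `{0, …, m - 1}`: substitute the `i`-th letter of `U` for the `i`-th parameter
of `W`, and truncate before the first parameter that did not receive a value. -/
structure IsParamMap (m : ℕ) (F : List ℕ → List ℕ) : Prop where
  map_eq : ∀ (σ : ℕ → ℕ), (∀ i < m, σ i = i) → ∀ U, F (U.map σ) = (F U).map σ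
  snoc : ∀ U a, ∃ s, F (U ++ [a]) = F U ++ a :: s

/-- `IsParamWord m m' U` says that `U` is a finite parameter word over the alphabet
`{0, …, m - 1}` whose parameters `m, …, m' - 1` all occur, in this order of first occurrence. -/
def IsParamWord : ℕ → ℕ → List ℕ → Prop
  | m, m', [] => m = m'
  | m, m', a :: U => (a < m ∧ IsParamWord m m' U) ∨ (a = m ∧ IsParamWord (m + 1) m' U)

theorem isParamWord_append {m m' : ℕ} {U V : List ℕ} :
    IsParamWord m m' (U ++ V) ↔ ∃ l, IsParamWord m l U ∧ IsParamWord l m' V := by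
  induction U generalizing m with
  | nil => simp [IsParamWord]
  | cons a U ih =>
    simp only [List.cons_append, IsParamWord, ih]
    constructor
    · rintro (⟨h, l, h1, h2⟩ | ⟨h, l, h1, h2⟩)
      · exact ⟨l, Or.inl ⟨h, h1⟩, h2⟩
      · exact ⟨l, Or.inr ⟨h, h1⟩, h2⟩
    · rintro ⟨l, ⟨h, h1⟩ | ⟨h, h1⟩, h2⟩
      · exact Or.inl ⟨h, l, h1, h2⟩
      · exact Or.inr ⟨h, l, h1, h2⟩

theorem isParamWord_self {m : ℕ} {U : List ℕ} (h : ∀ a ∈ U, a < m) : IsParamWord m m U := by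
  induction U with
  | nil => rfl
  | cons a U ih =>
    exact Or.inl ⟨h a (by simp), ih fun b hb => h b (by simp [hb])⟩

theorem IsParamWord.le_and_lt {m m' : ℕ} {U : List ℕ} (h : IsParamWord m m' U) :
    m ≤ m' ∧ ∀ a ∈ U, a < m' := by
  induction U generalizing m with
  | nil => exact ⟨h.le, by simp⟩
  | cons a U ih =>
    rcases h with ⟨h, h'⟩ | ⟨h, h'⟩
    · obtain ⟨h1, h2⟩ := ih h'
      exact ⟨h1, by simp only [List.mem_cons]; rintro b (rfl | hb); exacts [by omega, h2 b hb]⟩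
    · obtain ⟨h1, h2⟩ := ih h'
      exact ⟨by omega,
        by simp only [List.mem_cons]; rintro b (rfl | hb); exacts [by omega, h2 b hb]⟩

theorem IsParamWord.exists_eq_append_cons {m m' : ℕ} {U : List ℕ} (h : IsParamWord m m' U)
    (hm : m < m') :
    ∃ v V, U = v ++ m :: V ∧ (∀ a ∈ v, a < m) ∧ IsParamWord (m + 1) m' V := by
  induction U with
  | nil => exact absurd h hm.ne
  | cons a U ih =>
    rcases h with ⟨ha, h⟩ | ⟨rfl, h⟩
    · obtain ⟨v, V, rfl, hv, hV⟩ := ih h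
      exact ⟨a :: v, V, rfl,
        by simp only [List.mem_cons]; rintro b (rfl | hb); exacts [ha, hv b hb], hV⟩
    · exact ⟨[], U, rfl, by simp, h⟩

theorem isParamWord_append_cons {m m' : ℕ} {v V : List ℕ} (hv : ∀ a ∈ v, a < m) :
    IsParamWord m m' (v ++ m :: V) ↔ IsParamWord (m + 1) m' V := by
  induction v with
  | nil => simp [IsParamWord]
  | cons a v ih =>
    have ha : a < m := hv a (by simp)
    simp [IsParamWord, ha, ha.ne, ih fun b hb => hv b (by simp [hb])]

theorem exists_isParamWord (k : ℕ) : ∀ m, ∃ U, IsParamWord m (m + k) U := by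
  induction k with
  | zero => exact fun m => ⟨[], rfl⟩
  | succ k ih =>
    intro m
    obtain ⟨U, hU⟩ := ih (m + 1)
    exact ⟨m :: U, Or.inr ⟨rfl, by rwa [show m + (k + 1) = m + 1 + k by omega]⟩⟩

namespace IsParamMap

variable {m : ℕ} {F G : List ℕ → List ℕ}

protected theorem id : IsParamMap m id := ⟨fun _ _ _ => rfl, fun _ _ => ⟨[], rfl⟩⟩

theorem append (hF : IsParamMap m F) (U V : List ℕ) : ∃ s, F (U ++ V) = F U ++ s := by
  induction V using List.reverseRecOn with
  | nil => exact ⟨[], by simp⟩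
  | append_singleton V a ih =>
    obtain ⟨s, hs⟩ := ih
    obtain ⟨s', hs'⟩ := hF.snoc (U ++ V) a
    exact ⟨s ++ a :: s', by rw [← List.append_assoc, hs', hs, List.append_assoc]⟩

theorem append_cons (hF : IsParamMap m F) (U V : List ℕ) (a : ℕ) :
    ∃ s, F (U ++ a :: V) = F U ++ a :: s := by
  obtain ⟨s, hs⟩ := hF.append (U ++ [a]) V
  obtain ⟨s', hs'⟩ := hF.snoc U a
  exact ⟨s' ++ s, by simp_all⟩

theorem comp (hF : IsParamMap m F) (hG : IsParamMap m G) : IsParamMap m (F ∘ G) := by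
  refine ⟨fun σ hσ U => ?_, fun U a => ?_⟩
  · simp [hG.map_eq σ hσ, hF.map_eq σ hσ]
  · obtain ⟨s, hs⟩ := hG.snoc U a
    simpa [hs] using hF.append_cons (G U) s a

theorem lt_or_mem (hF : IsParamMap m F) {U : List ℕ} {b : ℕ} (hb : b ∈ F U) : b < m ∨ b ∈ U := by
  by_contra! h
  have hσ := hF.map_eq (fun i => if i = b then b + 1 else i)
    (fun i hi => if_neg (by omega)) U
  rw [List.map_congr_left (g := id), List.map_id] at hσ
  · rw [hσ, List.mem_map] at hb
    obtain ⟨i, -, hi⟩ := hb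
    split_ifs at hi <;> omega
  · intro i hi
    have hib : i ≠ b := by
      rintro rfl
      exact h.2 hi
    simp [hib]

theorem isParamWord (hF : IsParamMap m F) {m' : ℕ} {U : List ℕ} (hU : IsParamWord m m' U) :
    IsParamWord m m' (F U) := by
  induction U using List.reverseRecOn generalizing m' with
  | nil =>
    obtain rfl : m = m' := hU
    exact isParamWord_self fun a ha => (hF.lt_or_mem ha).resolve_right (by simp)
  | append_singleton U a ih =>
    have hlt := hU.le_and_lt
    obtain ⟨s, hs⟩ := hF.snoc U a
    have hs' : ∀ b ∈ s, b < m' := fun b hb => by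
      rcases hF.lt_or_mem (U := U ++ [a]) (b := b) (by simp [hs, hb]) with h | h
      · omega
      · exact hlt.2 b h
    obtain ⟨l, h1, h2⟩ := isParamWord_append.1 hU
    rw [hs]
    refine isParamWord_append.2 ⟨l, ih h1, ?_⟩
    rcases h2 with ⟨h, rfl⟩ | ⟨h, rfl⟩
    · exact Or.inl ⟨h, isParamWord_self hs'⟩
    · exact Or.inr ⟨h, isParamWord_self hs'⟩

end IsParamMap

/-- Substitution of the letter `a` for the parameter of a word over `{0, …, m - 1}`. -/
def substParam (m a i : ℕ) : ℕ := if i < m then i else a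

theorem exists_mono_list {κ : Type*} [Finite κ] (m : ℕ) (c : List ℕ → κ) :
    ∃ B : Set (List ℕ), (∃ w ∈ B, ∀ x ∈ w, x < m) ∧ (∀ x ∈ B, ∀ y ∈ B, c x = c y) ∧
      ∀ E : Finset (List ℕ), ↑E ⊆ B → ∃ t : List ℕ, ∀ w ∈ E, ∀ a < m,
        w ++ a :: t.map (substParam m a) ∈ B := by
  let _ : Semigroup (List ℕ) := { mul := (· ++ ·), mul_assoc := List.append_assoc }
  have hmul : ∀ x y : List ℕ, x * y = x ++ y := fun _ _ => rfl
  obtain ⟨B, hS, hc, hB⟩ := exists_mono_closed_under_substitution (T := List ℕ) (ι := Fin m)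
    {w | ∀ x ∈ w, x < m} {w | ∃ t, w = m :: t} ⟨[], by simp⟩
    (fun x hx y hy z hz => (List.mem_append.1 hz).elim (hx z) (hy z))
    ⟨[m], [], rfl⟩ (by rintro _ ⟨t, rfl⟩ y; exact ⟨t ++ y, rfl⟩)
    (fun a => { toFun := List.map (substParam m a), map_mul' := fun _ _ => List.map_append })
    (fun a x z hz => by
      obtain ⟨i, -, rfl⟩ := List.mem_map.1 hz
      unfold substParam
      split_ifs with h
      exacts [h, a.2])
    (fun a x hx => by
      change List.map (substParam m a) x = x
      rw [List.map_congr_left (g := id), List.map_id]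
      exact fun i hi => if_pos (hx i hi)) c
  refine ⟨B, hS, hc, fun E hE => ?_⟩
  obtain ⟨_, ⟨t, rfl⟩, ht⟩ := hB E hE
  refine ⟨t, fun w hw a ha => ?_⟩
  have := ht w hw ⟨a, ha⟩
  change w ++ List.map (substParam m a) (m :: t) ∈ B at this
  simpa [substParam] using this

/-- The concatenation of the blocks `t n, t (n + 1), …`, where the `i`-th block is preceded by the
`i`-th letter of the argument, which is also substituted for its parameter. -/
def substBlocks (m : ℕ) (t : ℕ → List ℕ) : ℕ → List ℕ → List ℕ
  | _, [] => []
  | n, a :: U => a :: (t n).map (substParam m a) ++ substBlocks m t (n + 1) U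

theorem isParamMap_substBlocks {m : ℕ} (t : ℕ → List ℕ) {w : List ℕ} (hw : ∀ x ∈ w, x < m) (n : ℕ) :
    IsParamMap m (fun U => w ++ substBlocks m t n U) := by
  refine ⟨fun σ hσ U => ?_, fun U a => ?_⟩
  · have hw' : w.map σ = w := by
      rw [List.map_congr_left (g := id), List.map_id]
      exact fun i hi => hσ i (hw i hi)
    have hU : substBlocks m t n (U.map σ) = (substBlocks m t n U).map σ := by
      induction U generalizing n with
      | nil => rfl
      | cons a U ih =>
        simp only [List.map_cons, substBlocks, ih, List.map_append, List.map_map]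
        congr 3
        funext i
        simp only [substParam, Function.comp]
        split_ifs with h
        exacts [(hσ i h).symm, rfl]
    simp [hw', hU]
  · have hU : ∃ s, substBlocks m t n (U ++ [a]) = substBlocks m t n U ++ a :: s := by
      induction U generalizing n with
      | nil => exact ⟨_, rfl⟩
      | cons b U ih =>
        obtain ⟨s, hs⟩ := ih (n + 1)
        exact ⟨s, by simp [substBlocks, hs]⟩
    obtain ⟨s, hs⟩ := hU
    exact ⟨s, by simp [hs]⟩

/-- A form of the **Carlson–Simpson theorem**. -/
theorem exists_isParamMap_mono_words {κ : Type*} [Finite κ] (m : ℕ) (c : List ℕ → κ) :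
    ∃ F, IsParamMap m F ∧ ∀ U V : List ℕ, (∀ a ∈ U, a < m) → (∀ a ∈ V, a < m) →
      c (F U) = c (F V) := by
  obtain ⟨B, ⟨w, hwB, hw⟩, hc, hB⟩ := exists_mono_list m c
  have hB' : ∀ E : Finset (List ℕ), ∃ t : List ℕ, (E : Set (List ℕ)) ⊆ B → ∀ w ∈ E, ∀ a < m,
      w ++ a :: t.map (substParam m a) ∈ B := fun E => by
    by_cases hE : (E : Set (List ℕ)) ⊆ B
    · obtain ⟨t, ht⟩ := hB E hE
      exact ⟨t, fun _ => ht⟩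
    · exact ⟨[], fun h => absurd h hE⟩
  choose t ht using hB'
  let E : ℕ → Finset (List ℕ) := fun n => Nat.rec {w} (fun _ E => E ∪
    (E ×ˢ Finset.range m).image fun p => p.1 ++ p.2 :: (t E).map (substParam m p.2)) n
  have hE : ∀ n, E (n + 1) = E n ∪ (E n ×ˢ Finset.range m).image
      fun p => p.1 ++ p.2 :: (t (E n)).map (substParam m p.2) := fun n => rfl
  have hEB : ∀ n, ∀ x ∈ E n, x ∈ B := fun n => by
    induction n with
    | zero => simpa [E] using hwB
    | succ n ih =>
      intro x hx
      rw [hE, Finset.mem_union, Finset.mem_image] at hx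
      rcases hx with hx | ⟨⟨y, a⟩, hp, rfl⟩
      · exact ih x hx
      · rw [Finset.mem_product, Finset.mem_range] at hp
        exact ht (E n) ih y hp.1 a hp.2
  have key : ∀ (U : List ℕ) (n : ℕ), (∀ a ∈ U, a < m) → ∀ y ∈ E n,
      y ++ substBlocks m (fun n => t (E n)) n U ∈ B := fun U => by
    induction U with
    | nil => exact fun n _ y hy => by simpa [substBlocks] using hEB n y hy
    | cons a U ih =>
      intro n hU y hy
      have := ih (n + 1) (fun b hb => hU b (by simp [hb]))
        (y ++ a :: (t (E n)).map (substParam m a)) (by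
          rw [hE, Finset.mem_union, Finset.mem_image]
          exact Or.inr ⟨(y, a), by simp [hy, hU a (by simp)], rfl⟩)
      simpa [substBlocks] using this
  exact ⟨_, isParamMap_substBlocks _ hw 0, fun U V hU hV =>
    hc _ (key U 0 hU w (by simp [E])) _ (key V 0 hV w (by simp [E]))⟩

/-- The renaming of letters that makes room for the additional constant `m`. -/
def shiftParam (m i : ℕ) : ℕ := if i < m then i else i + 1

/-- The inverse of `shiftParam m` sending the additional constant `m` to `a`. -/
def unshiftParam (m a i : ℕ) : ℕ := if i < m then i else if i = m then a else i - 1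

theorem unshiftParam_shiftParam (m a i : ℕ) : unshiftParam m a (shiftParam m i) = i := by
  unfold unshiftParam shiftParam
  split_ifs <;> omega

/-- The parameter map fixing the words of length at most `n`, and acting by `H` on what follows
the `n`-th letter, with that letter substituted for the constant `m` of `H`. -/
def actAfter (m n : ℕ) (H : List ℕ → List ℕ) (X : List ℕ) : List ℕ :=
  match X.drop n with
  | [] => X
  | a :: Z => X.take n ++ a :: (H (Z.map (shiftParam m))).map (unshiftParam m a)

theorem actAfter_of_length_le {m n : ℕ} (H : List ℕ → List ℕ) {X : List ℕ} (h : X.length ≤ n) :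
    actAfter m n H X = X := by
  simp [actAfter, List.drop_eq_nil_of_le h]

theorem actAfter_append_cons (m : ℕ) (H : List ℕ → List ℕ) (v : List ℕ) (a : ℕ) (Z : List ℕ) :
    actAfter m v.length H (v ++ a :: Z) =
      v ++ a :: (H (Z.map (shiftParam m))).map (unshiftParam m a) := by
  simp [actAfter]

theorem List.length_le_or_exists_eq_append_cons (X : List ℕ) (n : ℕ) :
    X.length ≤ n ∨ ∃ v a Z, v.length = n ∧ X = v ++ a :: Z := by
  rcases Nat.lt_or_ge n X.length with h | h
  · exact Or.inr ⟨X.take n, X[n], X.drop (n + 1), by simp; omega, by simp⟩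
  · exact Or.inl h

theorem isParamMap_actAfter {m : ℕ} {H : List ℕ → List ℕ} (hH : IsParamMap (m + 1) H) (n : ℕ) :
    IsParamMap m (actAfter m n H) := by
  refine ⟨fun σ hσ X => ?_, fun X b => ?_⟩
  · rcases X.length_le_or_exists_eq_append_cons n with h | ⟨v, a, Z, rfl, rfl⟩
    · rw [actAfter_of_length_le H h, actAfter_of_length_le H (by simpa using h)]
    · have h := actAfter_append_cons m H (v.map σ) (σ a) (Z.map σ)
      rw [List.length_map] at h
      rw [actAfter_append_cons, List.map_append, List.map_cons, h, List.map_append, List.map_cons]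
      congr 2
      let τ : ℕ → ℕ := fun i => if i ≤ m then i else shiftParam m (σ (i - 1))
      have hZ : (Z.map σ).map (shiftParam m) = (Z.map (shiftParam m)).map τ := by
        rw [List.map_map, List.map_map]
        refine List.map_congr_left fun i _ => ?_
        by_cases hi : i < m
        · simp [τ, shiftParam, hi, hσ i hi, hi.le]
        · simp only [τ, shiftParam, Function.comp, hi, if_false]
          rw [if_neg (by omega : ¬ i + 1 ≤ m), Nat.add_sub_cancel]
      rw [hZ, hH.map_eq τ (fun i hi => if_pos (by omega)), List.map_map, List.map_map]
      refine List.map_congr_left fun i _ => ?_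
      simp only [τ, Function.comp]
      rcases lt_trichotomy i m with hi | rfl | hi
      · simp [unshiftParam, hi, hσ i hi, hi.le]
      · simp [unshiftParam]
      · rw [if_neg (by omega), unshiftParam_shiftParam, unshiftParam, if_neg (by omega),
          if_neg (by omega)]
  · rcases X.length_le_or_exists_eq_append_cons n with h | ⟨v, a, Z, rfl, rfl⟩
    · rw [actAfter_of_length_le H h]
      rcases h.lt_or_eq with h | rfl
      · exact ⟨[], actAfter_of_length_le H (by simpa using h)⟩
      · exact ⟨_, actAfter_append_cons m H X b []⟩
    · obtain ⟨s, hs⟩ := hH.snoc (Z.map (shiftParam m)) (shiftParam m b)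
      rw [List.append_assoc, List.cons_append, actAfter_append_cons, actAfter_append_cons]
      exact ⟨s.map (unshiftParam m a), by simp [hs, unshiftParam_shiftParam]⟩

/-- The homogeneity conclusion of the theorem on parameter words with `k` parameters. -/
def ParamWordsRamsey (m k : ℕ) : Prop :=
  ∀ {κ : Type} [Finite κ] (c : List ℕ → κ), ∃ F, IsParamMap m F ∧
    ∀ U V, IsParamWord m (m + k) U → IsParamWord m (m + k) V → c (F U) = c (F V)

theorem ParamWordsRamsey.exists_fixing {m k : ℕ} (h : ParamWordsRamsey (m + 1) k) {κ : Type}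
    [Finite κ] (c : List ℕ → κ) (n : ℕ) :
    ∃ G, IsParamMap m G ∧ (∀ X : List ℕ, X.length ≤ n → G X = X) ∧
      ∀ v : List ℕ, v.length = n → (∀ a ∈ v, a < m) →
        ∀ V V', IsParamWord (m + 1) (m + 1 + k) V → IsParamWord (m + 1) (m + 1 + k) V' →
          c (G (v ++ m :: V)) = c (G (v ++ m :: V')) := by
  obtain ⟨H, hH, hc⟩ := h (κ := (Fin n → Fin m) → κ)
    fun V x => c (List.ofFn (fun i => (x i : ℕ)) ++ m :: V)
  refine ⟨actAfter m n H, isParamMap_actAfter hH n, fun X => actAfter_of_length_le H, ?_⟩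
  rintro v rfl hv V V' hV hV'
  have key : ∀ V, actAfter m v.length H (v ++ m :: V) = v ++ m :: H V := fun V => by
    rw [actAfter_append_cons, ← hH.map_eq, List.map_map, List.map_congr_left (g := id), List.map_id]
    · exact fun i _ => unshiftParam_shiftParam m m i
    · intro i hi
      unfold unshiftParam
      split_ifs <;> omega
  have := congrFun (hc V V' hV hV') fun i => ⟨v[i], hv _ (List.getElem_mem _)⟩
  simpa [key] using this

theorem ParamWordsRamsey.exists_fusion {m k : ℕ} (h : ParamWordsRamsey (m + 1) k) {κ : Type}
    [Finite κ] (c : List ℕ → κ) :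
    ∃ F, IsParamMap m F ∧ ∀ v : List ℕ, (∀ a ∈ v, a < m) →
      ∀ V V', IsParamWord (m + 1) (m + 1 + k) V → IsParamWord (m + 1) (m + 1 + k) V' →
        c (F (v ++ m :: V)) = c (F (v ++ m :: V')) := by
  have hstep := fun (F : List ℕ → List ℕ) (n : ℕ) => h.exists_fixing (fun U => c (F U)) n
  choose G hG hfix hc using hstep
  let F : ℕ → List ℕ → List ℕ := fun n => Nat.rec id (fun n F => F ∘ G F n) n
  have hFsucc : ∀ n, F (n + 1) = F n ∘ G (F n) n := fun n => rfl
  have hF : ∀ n, IsParamMap m (F n) := fun n => by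
    induction n with
    | zero => exact .id
    | succ n ih => exact ih.comp (hG _ _)
  refine ⟨fun U => F U.length U, ⟨fun σ hσ U => ?_, fun U a => ?_⟩, fun v hv V V' hV hV' => ?_⟩
  · simpa using (hF U.length).map_eq σ hσ U
  · obtain ⟨s, hs⟩ := (hG (F U.length) U.length).snoc U a
    rw [hfix _ _ _ le_rfl] at hs
    simpa [hFsucc, hs] using (hF U.length).append_cons U s a
  · have key : ∀ (N : ℕ) (V : List ℕ), IsParamWord (m + 1) (m + 1 + k) V →
        ∃ V', IsParamWord (m + 1) (m + 1 + k) V' ∧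
          F (v.length + 1 + N) (v ++ m :: V) = F (v.length + 1) (v ++ m :: V') := fun N => by
      induction N with
      | zero => exact fun V hV => ⟨V, hV, rfl⟩
      | succ N ih =>
        intro V hV
        have hG' := hG (F (v.length + 1 + N)) (v.length + 1 + N)
        obtain ⟨s, hs⟩ := hG'.append (v ++ [m]) V
        rw [hfix _ _ (v ++ [m]) (by simp), List.append_assoc v [m] V, List.append_assoc v [m] s] at hs
        have hs' := hG'.isParamWord ((isParamWord_append_cons hv).2 hV)
        simp only [List.singleton_append] at hs
        rw [hs, isParamWord_append_cons hv] at hs'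
        obtain ⟨V', hV', h⟩ := ih s hs'
        refine ⟨V', hV', ?_⟩
        rw [← h, ← add_assoc, hFsucc, Function.comp, hs]
    have hlen : ∀ V : List ℕ, (v ++ m :: V).length = v.length + 1 + V.length := fun V => by
      simp; omega
    obtain ⟨V₁, hV₁, h₁⟩ := key V.length V hV
    obtain ⟨V₂, hV₂, h₂⟩ := key V'.length V' hV'
    simp only [hlen]
    rw [h₁, h₂]
    exact hc (F v.length) v.length v rfl hv V₁ V₂ hV₁ hV₂

/-- The Ramsey theorem for finite parameter words, inside an infinite parameter word. -/
theorem paramWordsRamsey (k : ℕ) : ∀ m, ParamWordsRamsey m k := by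
  induction k with
  | zero =>
    intro m κ _ c
    obtain ⟨F, hF, h⟩ := exists_isParamMap_mono_words m c
    exact ⟨F, hF, fun U V hU hV => h U V hU.le_and_lt.2 hV.le_and_lt.2⟩
  | succ k ih =>
    intro m κ _ c
    have hk : m + 1 + k = m + (k + 1) := by omega
    obtain ⟨F, hF, hc⟩ := ParamWordsRamsey.exists_fusion (ih (m + 1)) c
    obtain ⟨V₀, hV₀⟩ := exists_isParamWord k (m + 1)
    obtain ⟨G, hG, h⟩ := exists_isParamMap_mono_words m fun v => c (F (v ++ m :: V₀))
    rw [hk] at hc hV₀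
    have key : ∀ U, IsParamWord m (m + (k + 1)) U → ∃ v : List ℕ, (∀ a ∈ v, a < m) ∧
        c (F (G U)) = c (F (G v ++ m :: V₀)) := fun U hU => by
      obtain ⟨v, V, rfl, hv, -⟩ := hU.exists_eq_append_cons (by omega)
      have hGU := hG.isParamWord hU
      obtain ⟨s, hs⟩ := hG.append_cons v V m
      have hGv : ∀ a ∈ G v, a < m := fun a ha => (hG.lt_or_mem ha).elim id (hv a)
      rw [hs, isParamWord_append_cons hGv] at hGU
      exact ⟨v, hv, by rw [hs]; exact hc _ hGv _ _ hGU hV₀⟩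
    refine ⟨F ∘ G, hF.comp hG, fun U V hU hV => ?_⟩
    obtain ⟨u, hu, hu'⟩ := key U hU
    obtain ⟨v, hv, hv'⟩ := key V hV
    simp only [Function.comp, hu', hv']
    exact h u v hu hv

theorem exists_isParamMap_forall_le {κ : Type} [Finite κ] (m K : ℕ) (c : List ℕ → κ) :
    ∃ F, IsParamMap m F ∧ ∀ k ≤ K, ∀ U V, IsParamWord m (m + k) U → IsParamWord m (m + k) V →
      c (F U) = c (F V) := by
  induction K with
  | zero =>
    obtain ⟨F, hF, h⟩ := paramWordsRamsey 0 m c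
    exact ⟨F, hF, fun k hk => by rwa [Nat.le_zero.1 hk]⟩
  | succ K ih =>
    obtain ⟨F, hF, h⟩ := ih
    obtain ⟨G, hG, h'⟩ := paramWordsRamsey (K + 1) m (c ∘ F)
    refine ⟨F ∘ G, hF.comp hG, fun k hk U V hU hV => ?_⟩
    rcases hk.lt_or_eq with hk | rfl
    · exact h k (by omega) _ _ (hG.isParamWord hU) (hG.isParamWord hV)
    · exact h' U V hU hV

/-- The letters of `U` before the first one that is at least `l`, renamed according to `f`. -/
def evalWord (U : List ℕ) (l : ℕ) (f : ℕ → ℕ) : List ℕ := (U.takeWhile (· < l)).map f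

theorem List.forall_lt_or_exists_eq_append_cons (U : List ℕ) (l : ℕ) :
    (∀ a ∈ U, a < l) ∨ ∃ X y Y, U = X ++ y :: Y ∧ (∀ a ∈ X, a < l) ∧ l ≤ y := by
  induction U with
  | nil => simp
  | cons a U ih =>
    rcases Nat.lt_or_ge a l with ha | ha
    · rcases ih with h | ⟨X, y, Y, rfl, hX, hy⟩
      · exact Or.inl (by simpa [ha] using h)
      · exact Or.inr ⟨a :: X, y, Y, rfl, by simpa [ha] using hX, hy⟩
    · exact Or.inr ⟨[], a, U, rfl, by simp, ha⟩

theorem evalWord_of_forall_lt {U : List ℕ} {l : ℕ} (h : ∀ a ∈ U, a < l) (f : ℕ → ℕ) :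
    evalWord U l f = U.map f := by
  rw [evalWord, List.takeWhile_eq_self_iff.2 (by simpa using h)]

theorem evalWord_append_cons {U : List ℕ} {l y : ℕ} (h : ∀ a ∈ U, a < l) (hy : l ≤ y)
    (V : List ℕ) (f : ℕ → ℕ) : evalWord (U ++ y :: V) l f = U.map f := by
  rw [evalWord, List.takeWhile_append_of_pos (by simpa using h)]
  simp [hy]

theorem IsParamMap.evalWord {F : List ℕ → List ℕ} (hF : IsParamMap 0 F) (U : List ℕ) (l : ℕ)
    (f : ℕ → ℕ) : F (evalWord U l f) = _root_.evalWord (F U) l f := by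
  have hlt : ∀ X : List ℕ, (∀ a ∈ X, a < l) → ∀ a ∈ F X, a < l := fun X hX a ha =>
    hX a ((hF.lt_or_mem ha).resolve_left (by omega))
  rcases U.forall_lt_or_exists_eq_append_cons l with h | ⟨X, y, Y, rfl, hX, hy⟩
  · rw [evalWord_of_forall_lt h, evalWord_of_forall_lt (hlt U h), hF.map_eq f (by simp)]
  · obtain ⟨s, hs⟩ := hF.append_cons X Y y
    rw [evalWord_append_cons hX hy, hs, evalWord_append_cons (hlt X hX) hy, hF.map_eq f (by simp)]

/-- Every word factors through the list of its letters in order of first occurrence. -/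
theorem exists_isParamWord_map_eq {α : Type*} [DecidableEq α] (d₀ : α) (X : List α) :
    ∃ (D : List α) (U : List ℕ), D.Sublist X ∧ D.Nodup ∧ IsParamWord 0 D.length U ∧
      U.map (D.getD · d₀) = X := by
  induction X using List.reverseRecOn with
  | nil => exact ⟨[], [], by simp, by simp, rfl, rfl⟩
  | append_singleton X a ih =>
    obtain ⟨D, U, hDX, hD, hU, hX⟩ := ih
    by_cases ha : a ∈ D
    · obtain ⟨i, hi, rfl⟩ := List.getElem_of_mem ha
      exact ⟨D, U ++ [i], hDX.trans (List.sublist_append_left _ _), hD,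
        isParamWord_append.2 ⟨_, hU, Or.inl ⟨hi, rfl⟩⟩, by rw [List.map_append, hX]; simp [hi]⟩
    · refine ⟨D ++ [a], U ++ [D.length], hDX.append_right _, ?_, ?_, ?_⟩
      · exact List.nodup_append'.2 ⟨hD, by simp, by simpa using ha⟩
      · exact isParamWord_append.2 ⟨_, hU, Or.inr ⟨rfl, by simp [IsParamWord]⟩⟩
      · rw [List.map_append, ← hX]
        congr 1
        · refine List.map_congr_left fun l hl => ?_
          exact List.getD_append _ _ _ _ (hU.le_and_lt.2 l hl)
        · simp

theorem List.lt_length_takeWhile_iff {α : Type*} {q : α → Bool} {D : List α}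
    (hD : D.Pairwise fun a b => q b → q a) (d₀ : α) {l : ℕ} (hl : l < D.length) :
    l < (D.takeWhile q).length ↔ q (D.getD l d₀) := by
  induction D generalizing l with
  | nil => simp at hl
  | cons a D ih =>
    rw [List.pairwise_cons] at hD
    cases l with
    | zero => by_cases h : q a <;> simp [h]
    | succ l =>
      have hl' : l < D.length := by simpa using hl
      by_cases h : q a
      · simpa [h] using ih hD.2 hl'
      · have : ¬ q (D.getD l d₀) := fun hq => h (hD.1 _ (by simp [hl']) hq)
        simpa [h] using this

theorem List.takeWhile_congr_of_mem {α : Type*} {p q : α → Bool} {U : List α}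
    (h : ∀ a ∈ U, p a = q a) : U.takeWhile p = U.takeWhile q := by
  induction U with
  | nil => rfl
  | cons a U ih =>
    rw [List.takeWhile_cons, List.takeWhile_cons, h a (by simp), ih fun b hb => h b (by simp [hb])]

theorem List.takeWhile_map_range_getD {u : List ℕ} (hu : ∀ a ∈ u, a < 2) {N : ℕ}
    (hN : u.length ≤ N) : ((List.range N).map (u.getD · 2)).takeWhile (· < 2) = u := by
  have h : (List.range N).map (u.getD · 2) = u ++ List.replicate (N - u.length) 2 := by
    refine List.ext_getElem (by simp; omega) fun i h₁ h₂ => ?_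
    rcases Nat.lt_or_ge i u.length with hi | hi
    · simp [List.getElem_append_left hi, hi]
    · simp [List.getElem_append_right hi, hi]
  rw [h, List.takeWhile_append_of_pos (by simpa using hu)]
  simp

/-- Finitely many binary words are obtained by evaluating a single parameter word with a bounded
number of parameters. -/
theorem exists_evalWord_eq {d : ℕ} (u : Fin d → List ℕ) (hu : ∀ j, ∀ a ∈ u j, a < 2) :
    ∃ k ≤ 3 ^ d, ∃ U, IsParamWord 0 k U ∧ ∃ (l : Fin d → ℕ) (f : Fin d → ℕ → ℕ),
      ∀ j, l j ≤ k ∧ (∀ i, f j i < 3) ∧ evalWord U (l j) (f j) = u j := by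
  let N := Finset.univ.sup fun j => (u j).length
  have hN : ∀ j, (u j).length ≤ N := fun j =>
    Finset.le_sup (f := fun j => (u j).length) (Finset.mem_univ j)
  let X : List (Fin d → ℕ) := (List.range N).map fun i j => (u j).getD i 2
  obtain ⟨D, U, hDX, hD, hU, hX⟩ := exists_isParamWord_map_eq (fun _ => 2) X
  have hget : ∀ j i, (u j).getD i 2 < 3 := fun j i => by
    rcases Nat.lt_or_ge i (u j).length with hi | hi
    · rw [List.getD_eq_getElem _ _ hi]
      exact (hu j _ (List.getElem_mem hi)).trans (by norm_num)
    · rw [List.getD_eq_default _ _ hi]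
      norm_num
  have hD3 : ∀ τ ∈ D, ∀ j, τ j < 3 := fun τ hτ j => by
    obtain ⟨i, -, rfl⟩ := List.mem_map.1 (hDX.subset hτ)
    exact hget j i
  refine ⟨D.length, ?_, U, hU, fun j => (D.takeWhile fun τ => τ j < 2).length,
    fun j i => D.getD i (fun _ => 2) j, fun j => ⟨(List.takeWhile_sublist _).length_le, ?_, ?_⟩⟩
  · rw [← List.toFinset_card_of_nodup hD]
    refine (Finset.card_le_card (t := Fintype.piFinset fun _ : Fin d => Finset.range 3)
      fun τ hτ => ?_).trans (by simp)
    simpa using hD3 τ (List.mem_toFinset.1 hτ)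
  · intro i
    dsimp only
    rcases Nat.lt_or_ge i D.length with hi | hi
    · rw [List.getD_eq_getElem _ _ hi]
      exact hD3 _ (List.getElem_mem hi) j
    · rw [List.getD_eq_default _ _ hi]
      norm_num
  · have hpair : D.Pairwise fun a b => decide (b j < 2) → decide (a j < 2) := by
      refine List.Pairwise.sublist hDX (List.pairwise_map.2 (List.pairwise_lt_range.imp ?_))
      intro i i' hii' h
      simp only [decide_eq_true_eq] at h ⊢
      have hi' : i' < (u j).length := by
        by_contra! hi'
        rw [List.getD_eq_default _ _ hi'] at h
        omega
      rw [List.getD_eq_getElem _ _ (hii'.trans hi')]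
      exact hu j _ (List.getElem_mem _)
    have hU' : U.takeWhile (· < (D.takeWhile fun τ => τ j < 2).length) =
        U.takeWhile ((fun τ : Fin d → ℕ => decide (τ j < 2)) ∘ (D.getD · fun _ => 2)) := by
      refine List.takeWhile_congr_of_mem fun l hl => Bool.eq_iff_iff.2 ?_
      simpa using List.lt_length_takeWhile_iff hpair (fun _ => 2) (hU.le_and_lt.2 l hl)
    have hXj : X.map (· j) = (List.range N).map ((u j).getD · 2) := by simp [X]
    have := List.takeWhile_map_range_getD (hu j) (hN j)
    rw [← hXj, ← hX, List.map_map, List.takeWhile_map] at this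
    rw [_root_.evalWord, hU']
    exact this

/-- The position of the words starting with a given letter, relative to the empty word, in the
dense order on binary words. -/
def sideOfHead : List ℕ → ℤ
  | [] => 0
  | 0 :: _ => -1
  | _ :: _ => 1

/-- The dyadic rational in `(-1, 1)` coded by a binary word. -/
def dyadicOfWord : List ℕ → ℚ
  | [] => 0
  | a :: w => ((if a = 0 then -1 else 1) + dyadicOfWord w) / 2

theorem abs_dyadicOfWord_lt (w : List ℕ) : |dyadicOfWord w| < 1 := by
  induction w with
  | nil => simp [dyadicOfWord]
  | cons a w ih =>
    rw [abs_lt] at ih ⊢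
    unfold dyadicOfWord
    split_ifs <;> constructor <;> linarith

theorem dyadicOfWord_lt_of_sideOfHead_lt {x y : List ℕ} (h : sideOfHead x < sideOfHead y) :
    dyadicOfWord x < dyadicOfWord y := by
  have hx := fun w => abs_lt.1 (abs_dyadicOfWord_lt w)
  rcases x with _ | ⟨_ | a, x⟩ <;> rcases y with _ | ⟨_ | b, y⟩ <;>
    simp [sideOfHead, dyadicOfWord] at h ⊢
  · linarith [(hx y).1]
  · linarith [(hx x).2]
  · linarith [(hx x).2, (hx y).1]

theorem dyadicOfWord_append_lt_iff (p x y : List ℕ) :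
    dyadicOfWord (p ++ x) < dyadicOfWord (p ++ y) ↔ dyadicOfWord x < dyadicOfWord y := by
  induction p with
  | nil => rfl
  | cons a p ih =>
    rw [← ih, List.cons_append, List.cons_append, dyadicOfWord, dyadicOfWord]
    constructor <;> intro h <;> linarith

theorem eq_or_exists_sideOfHead_ne {u v : List ℕ} (hu : ∀ a ∈ u, a < 2) (hv : ∀ a ∈ v, a < 2) :
    u = v ∨ ∃ p x y, u = p ++ x ∧ v = p ++ y ∧ sideOfHead x ≠ sideOfHead y := by
  induction u generalizing v with
  | nil =>
    rcases v with _ | ⟨_ | b, v⟩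
    · exact Or.inl rfl
    all_goals exact Or.inr ⟨[], [], _, rfl, rfl, by simp [sideOfHead]⟩
  | cons a u ih =>
    rcases v with _ | ⟨b, v⟩
    · refine Or.inr ⟨[], _, [], rfl, rfl, ?_⟩
      cases a <;> simp [sideOfHead]
    by_cases hab : a = b
    · subst hab
      rcases ih (fun b hb => hu b (by simp [hb])) (v := v) (fun b hb => hv b (by simp [hb])) with
        rfl | ⟨p, x, y, rfl, rfl, h⟩
      · exact Or.inl rfl
      · exact Or.inr ⟨a :: p, x, y, rfl, rfl, h⟩
    · refine Or.inr ⟨[], _, _, rfl, rfl, ?_⟩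
      have ha := hu a (by simp)
      have hb := hv b (by simp)
      interval_cases a <;> interval_cases b <;> simp_all [sideOfHead]

theorem exists_sideOfHead_lt {u v : List ℕ} (hu : ∀ a ∈ u, a < 2) (hv : ∀ a ∈ v, a < 2)
    (h : dyadicOfWord u < dyadicOfWord v) :
    ∃ p x y, u = p ++ x ∧ v = p ++ y ∧ sideOfHead x < sideOfHead y := by
  rcases eq_or_exists_sideOfHead_ne hu hv with rfl | ⟨p, x, y, rfl, rfl, hxy⟩
  · exact absurd h (lt_irrefl _)
  · refine ⟨p, x, y, rfl, rfl, hxy.lt_or_gt.resolve_right fun hyx => ?_⟩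
    rw [dyadicOfWord_append_lt_iff] at h
    exact h.not_gt (dyadicOfWord_lt_of_sideOfHead_lt hyx)

theorem sideOfHead_append {x : List ℕ} (hx : x ≠ []) (y : List ℕ) :
    sideOfHead (x ++ y) = sideOfHead x := by
  rcases x with _ | ⟨_ | a, x⟩
  exacts [absurd rfl hx, rfl, rfl]

theorem exists_dyadicOfWord_between {u v : List ℕ} (hu : ∀ a ∈ u, a < 2) (hv : ∀ a ∈ v, a < 2)
    (h : dyadicOfWord u < dyadicOfWord v) :
    ∃ w : List ℕ, (∀ a ∈ w, a < 2) ∧ dyadicOfWord u < dyadicOfWord w ∧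
      dyadicOfWord w < dyadicOfWord v := by
  obtain ⟨p, x, y, rfl, rfl, hxy⟩ := exists_sideOfHead_lt hu hv h
  rcases eq_or_ne x [] with rfl | hx
  · have hy : y ≠ [] := by
      rintro rfl
      exact lt_irrefl _ hxy
    refine ⟨p ++ (y ++ [0]), ?_, ?_, ?_⟩
    · intro a ha
      rw [← List.append_assoc, List.mem_append] at ha
      exact ha.elim (hv a) fun ha => by simp_all
    · rw [dyadicOfWord_append_lt_iff]
      exact dyadicOfWord_lt_of_sideOfHead_lt (by rwa [sideOfHead_append hy])
    · rw [dyadicOfWord_append_lt_iff]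
      nth_rw 2 [← List.append_nil y]
      rw [dyadicOfWord_append_lt_iff]
      norm_num [dyadicOfWord]
  · refine ⟨p ++ (x ++ [1]), ?_, ?_, ?_⟩
    · intro a ha
      rw [← List.append_assoc, List.mem_append] at ha
      exact ha.elim (hu a) fun ha => by simp_all
    · rw [dyadicOfWord_append_lt_iff]
      nth_rw 1 [← List.append_nil x]
      rw [dyadicOfWord_append_lt_iff]
      norm_num [dyadicOfWord]
    · rw [dyadicOfWord_append_lt_iff]
      exact dyadicOfWord_lt_of_sideOfHead_lt (by rwa [sideOfHead_append hx])

theorem IsParamMap.dyadicOfWord_lt {m : ℕ} {F : List ℕ → List ℕ} (hF : IsParamMap m F)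
    {u v : List ℕ} (hu : ∀ a ∈ u, a < 2) (hv : ∀ a ∈ v, a < 2)
    (h : dyadicOfWord u < dyadicOfWord v) : dyadicOfWord (F u) < dyadicOfWord (F v) := by
  obtain ⟨p, x, y, rfl, rfl, hxy⟩ := exists_sideOfHead_lt hu hv h
  have hside : ∀ x, ∃ x', F (p ++ x) = F p ++ x' ∧ sideOfHead x' = sideOfHead x := fun x => by
    rcases x with _ | ⟨a, x⟩
    · exact ⟨[], by simp, rfl⟩
    · obtain ⟨s, hs⟩ := hF.append_cons p x a
      exact ⟨a :: s, hs, by cases a <;> rfl⟩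
  obtain ⟨x', hx, hx'⟩ := hside x
  obtain ⟨y', hy, hy'⟩ := hside y
  rw [hx, hy, dyadicOfWord_append_lt_iff]
  exact dyadicOfWord_lt_of_sideOfHead_lt (by rwa [hx', hy'])

/-- The rationals embed into the densely ordered set of binary words. -/
theorem exists_strictMono_dyadicOfWord :
    ∃ g : ℚ → List ℕ, (∀ q, ∀ a ∈ g q, a < 2) ∧ StrictMono fun q => dyadicOfWord (g q) := by
  let D : Set ℚ := dyadicOfWord '' {w | ∀ a ∈ w, a < 2}
  have : DenselyOrdered D := ⟨by
    rintro ⟨_, u, hu, rfl⟩ ⟨_, v, hv, rfl⟩ h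
    obtain ⟨w, hw, h₁, h₂⟩ := exists_dyadicOfWord_between hu hv h
    exact ⟨⟨_, w, hw, rfl⟩, h₁, h₂⟩⟩
  have : Nontrivial D := ⟨⟨_, [], by simp, rfl⟩, ⟨_, [1], by simp, rfl⟩, by simp [dyadicOfWord]⟩
  obtain ⟨h⟩ := Order.embedding_from_countable_to_dense ℚ D
  choose g hg hgh using fun q => (h q).2
  refine ⟨g, hg, fun q q' hq => ?_⟩
  simp only [hgh]
  exact h.strictMono hq

/-- Finiteness of the big Ramsey degree of `d`-element subsets of `ℚ`. -/
theorem exists_bigRamseyDegree_bound (d : ℕ) :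
    ∃ t : ℕ, ∀ (k : ℕ) (c : Finset ℚ → Fin (k + 1)),
      ∃ Q' : Set ℚ, Nonempty (Q' ≃o ℚ) ∧
        ∃ colors : Finset (Fin (k + 1)), colors.card ≤ t ∧
          ∀ s : Finset ℚ, ↑s ⊆ Q' → s.card = d → c s ∈ colors := by
  classical
  let K := 3 ^ d
  let Par := Fin d → Fin (K + 1) × (Fin K → Fin 3)
  let extend : (Fin K → Fin 3) → ℕ → ℕ := fun f i => if h : i < K then f ⟨i, h⟩ else 0
  refine ⟨(K + 1) * Fintype.card Par, fun r c => ?_⟩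
  let χ : List ℕ → Par → Fin (r + 1) := fun U P =>
    c (Finset.univ.image fun j => dyadicOfWord (evalWord U (P j).1 (extend (P j).2)))
  obtain ⟨F, hF, hχ⟩ := exists_isParamMap_forall_le 0 K χ
  obtain ⟨g, hg, hgmono⟩ := exists_strictMono_dyadicOfWord
  let φ : ℚ → ℚ := fun q => dyadicOfWord (F (g q))
  have hφ : StrictMono φ := fun q q' h => hF.dyadicOfWord_lt (hg q) (hg q') (hgmono h)
  choose R hR using fun k => exists_isParamWord k 0
  refine ⟨Set.range φ, ⟨hφ.orderIso.symm⟩,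
    (Finset.range (K + 1) ×ˢ (Finset.univ : Finset Par)).image fun p => χ (F (R p.1)) p.2,
    Finset.card_image_le.trans (by simp), fun s hs hsd => ?_⟩
  let e := s.equivFinOfCardEq hsd
  choose q hq using fun j => hs (e.symm j).2
  obtain ⟨k, hk, U, hU, l, f, hlf⟩ := exists_evalWord_eq (fun j => g (q j)) fun j => hg (q j)
  let P : Par := fun j => (⟨l j, Nat.lt_succ_of_le ((hlf j).1.trans hk)⟩,
    fun i => ⟨f j i, (hlf j).2.1 i⟩)
  have hsP : s = Finset.univ.image fun j =>
      dyadicOfWord (evalWord (F U) (P j).1 (extend (P j).2)) := by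
    have hval : ∀ j, dyadicOfWord (evalWord (F U) (P j).1 (extend (P j).2)) = e.symm j := by
      intro j
      have hext : evalWord U (P j).1 (extend (P j).2) = evalWord U (l j) (f j) := by
        refine List.map_congr_left fun i hi => ?_
        have hiK : i < K := by
          have := hU.le_and_lt.2 i ((List.takeWhile_sublist _).subset hi)
          omega
        simp [extend, P, hiK]
      rw [← hF.evalWord, hext, (hlf j).2.2]
      exact hq j
    ext x
    simp only [hval, Finset.mem_image, Finset.mem_univ, true_and]
    exact ⟨fun hx => ⟨e ⟨x, hx⟩, by simp⟩, by rintro ⟨j, rfl⟩; exact (e.symm j).2⟩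
  rw [Finset.mem_image]
  refine ⟨(k, P), by simpa [Nat.lt_succ_iff] using hk, ?_⟩
  have h := congrFun (hχ k hk (R k) U (by simpa using hR k) (by simpa using hU)) P
  rw [h, hsP]

/-- **Devlin.** For each positive integer `d` there is a positive integer `t_d` (the `d`-th
tangent number) such that: (a) for every finite coloring of the `d`-element subsets of `ℚ`
there is a subset `Q' ⊆ ℚ` order-isomorphic to `ℚ` whose `d`-element subsets take at most
`t_d` colors; and (b) there is a coloring of the `d`-element subsets of `ℚ` into exactly
`t_d` colors such that every subset `Q' ⊆ ℚ` order-isomorphic to `ℚ` realizes all `t_d`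
colors on its `d`-element subsets. -/
theorem devlin (d : ℕ) (hd : 0 < d) :
    ∃ t : ℕ, 0 < t ∧
      (∀ (k : ℕ) (c : Finset ℚ → Fin (k + 1)),
        ∃ Q' : Set ℚ, Nonempty (Q' ≃o ℚ) ∧
          ∃ colors : Finset (Fin (k + 1)), colors.card ≤ t ∧
            ∀ s : Finset ℚ, ↑s ⊆ Q' → s.card = d → c s ∈ colors) ∧
      (∃ c : Finset ℚ → Fin t,
        ∀ Q' : Set ℚ, Nonempty (Q' ≃o ℚ) →
          ∀ ε : Fin t, ∃ s : Finset ℚ, ↑s ⊆ Q' ∧ s.card = d ∧ c s = ε) := by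
  classical
  let Bound : ℕ → Prop := fun t => ∀ (k : ℕ) (c : Finset ℚ → Fin (k + 1)),
    ∃ Q' : Set ℚ, Nonempty (Q' ≃o ℚ) ∧
      ∃ colors : Finset (Fin (k + 1)), colors.card ≤ t ∧
        ∀ s : Finset ℚ, ↑s ⊆ Q' → s.card = d → c s ∈ colors
  have hex : ∃ t, Bound t := exists_bigRamseyDegree_bound d
  let t := Nat.find hex
  have ht : Bound t := Nat.find_spec hex
  have hpos : 0 < t := by
    by_contra! h0
    obtain ⟨Q', ⟨e⟩, colors, hcard, hcolors⟩ := ht 0 fun _ => 0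
    have hinf : Q'.Infinite := Set.infinite_coe_iff.1 (Infinite.of_injective e.symm e.symm.injective)
    obtain ⟨s, hs, hsd⟩ := hinf.exists_subset_card_eq d
    have := Finset.card_pos.2 ⟨_, hcolors s hs hsd⟩
    omega
  refine ⟨t, hpos, ht, ?_⟩
  have hnot : ¬ Bound (t - 1) := Nat.find_min hex (by omega)
  simp only [Bound, not_forall] at hnot
  obtain ⟨k, c, hc⟩ := hnot
  have hlarge : ∀ Q' : Set ℚ, Nonempty (Q' ≃o ℚ) → ∀ colors : Finset (Fin (k + 1)),
      (∀ s : Finset ℚ, ↑s ⊆ Q' → s.card = d → c s ∈ colors) → t ≤ colors.card := by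
    intro Q' hQ' colors hcolors
    by_contra! h
    exact hc ⟨Q', hQ', colors, by omega, hcolors⟩
  obtain ⟨Q, ⟨e⟩, colors, hcard, hcolors⟩ := ht k c
  have hcard : colors.card = t := hcard.antisymm (hlarge Q ⟨e⟩ colors hcolors)
  let ψ : ℚ ↪o ℚ := e.symm.toOrderEmbedding.trans (OrderEmbedding.subtype _)
  have hψ : ∀ x, ψ x ∈ Q := fun x => (e.symm x).2
  let b := colors.equivFinOfCardEq hcard
  let c' : Finset ℚ → Fin t := fun s =>
    if h : c (s.map ψ.toEmbedding) ∈ colors then b ⟨_, h⟩ else ⟨0, hpos⟩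
  refine ⟨c', fun Q' ⟨e'⟩ ε => ?_⟩
  by_contra! hε
  let ρ : ℚ → ℚ := fun x => ψ (e'.symm x)
  have hρ : StrictMono ρ := ψ.strictMono.comp fun x y h => e'.symm.strictMono h
  have hle := hlarge (Set.range ρ) ⟨hρ.orderIso.symm⟩ (colors.erase (b.symm ε)) fun s hs hsd => by
    have hsQ : ↑s ⊆ Q := fun x hx => by
      obtain ⟨y, rfl⟩ := hs hx
      exact hψ _
    have hsψ : ↑s ⊆ ψ '' Q' := fun x hx => by
      obtain ⟨y, rfl⟩ := hs hx
      exact ⟨_, (e'.symm y).2, rfl⟩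
    obtain ⟨s', hs', rfl⟩ := Finset.subset_set_image_iff.1 hsψ
    have himage : s'.image ψ = s'.map ψ.toEmbedding := by
      rw [Finset.map_eq_image]
      rfl
    rw [himage] at hsQ hsd ⊢
    have hmem := hcolors _ hsQ hsd
    refine Finset.mem_erase.2 ⟨fun h => hε s' hs' (by simpa using hsd) ?_, hmem⟩
    simp only [c', dif_pos hmem]
    rw [← b.symm.injective.eq_iff, b.symm_apply_apply]
    exact Subtype.ext h
  rw [Finset.card_erase_of_mem (b.symm ε).2] at hle
  omega
end

section
/- (Henson) A countable triangle-free graph H is both universal for countable triangle-free graphs (every countable triangle-free graph embeds into H as an induced subgraph) and homogeneous (every isomorphism between two finite induced subgraphs of H extends to an automorphism of H) if and only if H satisfies the Henson extension property: for all disjoint finite sets U, V of vertices of H with U independent, there is a vertex of H adjacent to every vertex of U and to no vertex of V. -/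
/-- The Henson extension property (defining the universal triangle-free graph `H₃`): for all
disjoint finite sets `U, W` of vertices with `U` independent, there is a vertex (outside
`U ∪ W`) adjacent to every vertex of `U` and to no vertex of `W`. -/
def HensonExtProp {V : Type} (H : SimpleGraph V) : Prop :=
  ∀ U W : Finset V, Disjoint U W → (∀ u ∈ U, ∀ u' ∈ U, ¬ H.Adj u u') →
    ∃ v : V, v ∉ U ∧ v ∉ W ∧ (∀ u ∈ U, H.Adj v u) ∧ (∀ w ∈ W, ¬ H.Adj v w)

/-- A set of pairs of vertices that is the graph of an isomorphism between an induced subgraph of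
`G` and an induced subgraph of `H`. -/
def IsPartialIso {A B : Type} (G : SimpleGraph A) (H : SimpleGraph B) (S : Set (A × B)) : Prop :=
  ∀ p ∈ S, ∀ q ∈ S, (p.1 = q.1 ↔ p.2 = q.2) ∧ (G.Adj p.1 q.1 ↔ H.Adj p.2 q.2)

theorem SimpleGraph.CliqueFree.not_adj_of_adj_of_adj {V : Type} {G : SimpleGraph V}
    (h : G.CliqueFree 3) {a b c : V} (hab : G.Adj a b) (hac : G.Adj a c) : ¬ G.Adj b c := by
  classical
  exact fun hbc => h {a, b, c} (SimpleGraph.is3Clique_triple_iff.2 ⟨hab, hac, hbc⟩)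

theorem IsPartialIso.preimage_swap {A B : Type} {G : SimpleGraph A} {H : SimpleGraph B}
    {S : Set (A × B)} (h : IsPartialIso G H S) : IsPartialIso H G (Prod.swap ⁻¹' S) :=
  fun _ hp _ hq => ⟨(h _ hp _ hq).1.symm, (h _ hp _ hq).2.symm⟩

theorem IsPartialIso.exists_extension {A B : Type} {G : SimpleGraph A} {H : SimpleGraph B}
    (hG : G.CliqueFree 3) (hH : HensonExtProp H) {S : Set (A × B)} (hfin : S.Finite)
    (hS : IsPartialIso G H S) (a : A) :
    ∃ T : Set (A × B), T.Finite ∧ IsPartialIso G H T ∧ S ⊆ T ∧ ∃ b, (a, b) ∈ T := by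
  classical
  by_cases ha : ∃ b, (a, b) ∈ S
  · exact ⟨S, hfin, hS, subset_rfl, ha⟩
  let U : Finset B := (hfin.toFinset.filter fun p => G.Adj a p.1).image Prod.snd
  let W : Finset B := (hfin.toFinset.filter fun p => ¬ G.Adj a p.1).image Prod.snd
  have hU : ∀ p ∈ S, G.Adj a p.1 → p.2 ∈ U := fun p hp h =>
    Finset.mem_image_of_mem _ (by simp [hp, h])
  have hW : ∀ p ∈ S, ¬ G.Adj a p.1 → p.2 ∈ W := fun p hp h =>
    Finset.mem_image_of_mem _ (by simp [hp, h])
  have hdisj : Disjoint U W := by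
    simp only [Finset.disjoint_left, U, W, Finset.mem_image, Finset.mem_filter,
      Set.Finite.mem_toFinset]
    rintro _ ⟨p, ⟨hp, hap⟩, rfl⟩ ⟨q, ⟨hq, haq⟩, hqp⟩
    exact haq ((hS q hq p hp).1.2 hqp ▸ hap)
  have hind : ∀ u ∈ U, ∀ u' ∈ U, ¬ H.Adj u u' := by
    simp only [U, Finset.mem_image, Finset.mem_filter, Set.Finite.mem_toFinset]
    rintro _ ⟨p, ⟨hp, hap⟩, rfl⟩ _ ⟨q, ⟨hq, haq⟩, rfl⟩ h
    exact hG.not_adj_of_adj_of_adj hap haq ((hS p hp q hq).2.2 h)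
  obtain ⟨b, hbU, hbW, hadj, hnadj⟩ := hH U W hdisj hind
  have key : ∀ p ∈ S, a ≠ p.1 ∧ b ≠ p.2 ∧ (G.Adj a p.1 ↔ H.Adj b p.2) := by
    intro p hp
    refine ⟨fun h => ha ⟨p.2, h ▸ hp⟩, ?_, ?_⟩
    · rintro rfl
      exact (em (G.Adj a p.1)).elim (fun h => hbU (hU p hp h)) fun h => hbW (hW p hp h)
    · exact ⟨fun h => hadj _ (hU p hp h), fun h => by_contra fun h' => hnadj _ (hW p hp h') h⟩
  refine ⟨insert (a, b) S, hfin.insert _, ?_, Set.subset_insert _ _, b, Set.mem_insert _ _⟩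
  rintro p (rfl | hp) q (rfl | hq)
  · simp
  · obtain ⟨h₁, h₂, h₃⟩ := key q hq
    exact ⟨iff_of_false h₁ h₂, h₃⟩
  · obtain ⟨h₁, h₂, h₃⟩ := key p hp
    exact ⟨iff_of_false h₁.symm h₂.symm, by rw [G.adj_comm, H.adj_comm, h₃]⟩
  · exact hS p hp q hq

/-- A finite partial isomorphism extends to a partial isomorphism meeting countably many
requirements, provided that each of them is met by some finite extension of every finite partial
isomorphism. -/
theorem IsPartialIso.exists_generic {A B ι : Type} [Countable ι] {G : SimpleGraph A}
    {H : SimpleGraph B} {S : Set (A × B)} (hfin : S.Finite) (hS : IsPartialIso G H S)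
    (D : ι → Set (A × B))
    (hD : ∀ i, ∀ S : Set (A × B), S.Finite → IsPartialIso G H S →
      ∃ T : Set (A × B), T.Finite ∧ IsPartialIso G H T ∧ S ⊆ T ∧ ∃ p ∈ D i, p ∈ T) :
    ∃ R : Set (A × B), IsPartialIso G H R ∧ S ⊆ R ∧ ∀ i, ∃ p ∈ D i, p ∈ R := by
  have := Encodable.ofCountable ι
  let P := {S : Set (A × B) // S.Finite ∧ IsPartialIso G H S}
  let C : ι → Order.Cofinal P := fun i =>
    { carrier := {T | ∃ p ∈ D i, p ∈ T.1}
      isCofinal := fun T => by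
        obtain ⟨T', h₁, h₂, h₃, h₄⟩ := hD i T.1 T.2.1 T.2.2
        exact ⟨⟨T', h₁, h₂⟩, h₄, h₃⟩ }
  let I := Order.idealOfCofinals (⟨S, hfin, hS⟩ : P) C
  refine ⟨{p | ∃ T ∈ I, p ∈ T.1}, ?_, ?_, ?_⟩
  · rintro p ⟨T, hT, hp⟩ q ⟨T', hT', hq⟩
    obtain ⟨T'', -, h, h'⟩ := I.directed T hT T' hT'
    exact T''.2.2 p (h hp) q (h' hq)
  · exact fun p hp => ⟨_, Order.mem_idealOfCofinals _ C, hp⟩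
  · intro i
    obtain ⟨T, ⟨p, hpD, hp⟩, hT⟩ := Order.cofinal_meets_idealOfCofinals (⟨S, hfin, hS⟩ : P) C i
    exact ⟨p, hpD, T, hT, hp⟩

theorem HensonExtProp.nonempty_embedding {V W : Type} [Countable W] {H : SimpleGraph V}
    (hH : HensonExtProp H) {G : SimpleGraph W} (hG : G.CliqueFree 3) : Nonempty (G ↪g H) := by
  obtain ⟨R, hR, -, htot⟩ := IsPartialIso.exists_generic (G := G) (H := H) Set.finite_empty
    (fun _ hp => hp.elim) (fun a : W => {p | p.1 = a}) fun a S hfin hS => by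
      obtain ⟨T, h₁, h₂, h₃, b, h₄⟩ := hS.exists_extension hG hH hfin a
      exact ⟨T, h₁, h₂, h₃, _, rfl, h₄⟩
  have htot' : ∀ a, ∃ b, (a, b) ∈ R := fun a => by
    obtain ⟨⟨_, b⟩, rfl, h⟩ := htot a
    exact ⟨b, h⟩
  choose f hf using htot'
  exact ⟨⟨⟨f, fun a a' h => (hR _ (hf a) _ (hf a')).1.2 h⟩,
    fun {a a'} => (hR _ (hf a) _ (hf a')).2.symm⟩⟩

theorem IsPartialIso.exists_iso {V V' : Type} [Countable V] [Countable V'] {G : SimpleGraph V}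
    {H : SimpleGraph V'} (hG : G.CliqueFree 3) (hH : H.CliqueFree 3) (hG' : HensonExtProp G)
    (hH' : HensonExtProp H) {S : Set (V × V')} (hfin : S.Finite) (hS : IsPartialIso G H S) :
    ∃ ψ : G ≃g H, ∀ p ∈ S, ψ p.1 = p.2 := by
  obtain ⟨R, hR, hSR, htot⟩ := hS.exists_generic hfin
    (Sum.elim (fun a => {p | p.1 = a}) fun b => {p | p.2 = b}) (by
      rintro (a | b) S hfin hS
      · obtain ⟨T, h₁, h₂, h₃, b, h₄⟩ := hS.exists_extension hG hH' hfin a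
        exact ⟨T, h₁, h₂, h₃, _, rfl, h₄⟩
      · obtain ⟨T, h₁, h₂, h₃, a, h₄⟩ := hS.preimage_swap.exists_extension hH hG'
          (hfin.preimage Prod.swap_injective.injOn) b
        exact ⟨Prod.swap ⁻¹' T, h₁.preimage Prod.swap_injective.injOn, h₂.preimage_swap,
          fun p hp => h₃ (show p.swap.swap ∈ S from hp), (a, b), rfl, h₄⟩)
  have hleft : ∀ a, ∃ b, (a, b) ∈ R := fun a => by
    obtain ⟨⟨_, b⟩, rfl, h⟩ := htot (.inl a)
    exact ⟨b, h⟩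
  have hright : ∀ b, ∃ a, (a, b) ∈ R := fun b => by
    obtain ⟨⟨a, _⟩, rfl, h⟩ := htot (.inr b)
    exact ⟨a, h⟩
  choose f hf using hleft
  choose g hg using hright
  exact ⟨⟨⟨f, g, fun a => (hR _ (hg _) _ (hf a)).1.2 rfl, fun b => (hR _ (hf _) _ (hg b)).1.1 rfl⟩,
    fun {a a'} => (hR _ (hf a) _ (hf a')).2.symm⟩, fun p hp => (hR _ (hf p.1) _ (hSR hp)).1.1 rfl⟩

/-- The graph obtained from `G` by adding a new vertex with neighbourhood `U`. -/
def SimpleGraph.addVertex {A : Type} (G : SimpleGraph A) (U : Set A) :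
    SimpleGraph (Option A) where
  Adj
    | some a, some b => G.Adj a b
    | some a, none => a ∈ U
    | none, some b => b ∈ U
    | none, none => False
  symm := ⟨by
    rintro (_ | a) (_ | b) h
    exacts [h, h, h, G.adj_symm h]⟩
  loopless := ⟨by
    rintro (_ | a) h
    exacts [h, G.irrefl h]⟩

theorem SimpleGraph.CliqueFree.addVertex {A : Type} {G : SimpleGraph A} (hG : G.CliqueFree 3)
    {U : Set A} (hU : ∀ u ∈ U, ∀ u' ∈ U, ¬ G.Adj u u') : (G.addVertex U).CliqueFree 3 := by
  classical
  intro s hs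
  obtain ⟨a, b, c, hab, hac, hbc, -⟩ := SimpleGraph.is3Clique_iff.1 hs
  rcases a with _ | a <;> rcases b with _ | b <;> rcases c with _ | c
  exacts [hab, hab, hac, hU b hab c hac hbc, hbc, hU a hab c hbc hac, hU a hac b hbc hab,
    hG.not_adj_of_adj_of_adj hab hac hbc]

/-- **Henson.** A countable triangle-free graph `H` is both universal for countable
triangle-free graphs (every countable triangle-free graph embeds into `H` as an induced
subgraph) and homogeneous (every isomorphism between two finite induced subgraphs of `H`
extends to an automorphism of `H`) if and only if `H` satisfies the Henson extension
property. -/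
theorem henson_characterization {V : Type} [Countable V] (H : SimpleGraph V)
    (hTF : H.CliqueFree 3) :
    ((∀ (W : Type) [Countable W], ∀ G : SimpleGraph W, G.CliqueFree 3 → Nonempty (G ↪g H)) ∧
     (∀ (s t : Finset V) (φ : H.induce (s : Set V) ≃g H.induce (t : Set V)),
        ∃ ψ : H ≃g H, ∀ (v : V) (hv : v ∈ s),
          ψ v = ((φ ⟨v, Finset.mem_coe.mpr hv⟩ : (t : Set V)) : V))) ↔
    HensonExtProp H := by
  classical
  refine ⟨fun ⟨huniv, hhom⟩ U W hdisj hind => ?_, fun hH =>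
    ⟨fun _ _ _ hG => hH.nonempty_embedding hG, fun s t φ => ?_⟩⟩
  · let s : Finset V := U ∪ W
    obtain ⟨f⟩ := huniv _ ((H.induce (s : Set V)).addVertex {x | x.1 ∈ U}) <|
      (hTF.comap ⟨(SimpleGraph.Embedding.induce _).toCopy⟩).addVertex fun u hu u' hu' => hind _ hu _ hu'
    let t : Finset V := Finset.univ.image fun x : (s : Set V) => f (some x)
    let e : (s : Set V) ≃ (t : Set V) := Equiv.ofBijective
      (fun x => ⟨f (some x), by simp [t]⟩)
      ⟨fun x y h => Option.some_injective _ (f.injective (congrArg Subtype.val h)), by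
        rintro ⟨y, hy⟩
        obtain ⟨x, -, rfl⟩ := Finset.mem_image.1 hy
        exact ⟨x, rfl⟩⟩
    obtain ⟨ψ, hψ⟩ := hhom s t ⟨e, fun {x y} => f.map_rel_iff (a := some x) (b := some y)⟩
    have hψ' : ∀ v (hv : v ∈ s), ψ v = f (some ⟨v, hv⟩) := hψ
    have hne : ψ.symm (f none) ∉ s := fun h => by
      have := hψ' _ h
      rw [RelIso.apply_symm_apply] at this
      exact Option.some_ne_none _ (f.injective this).symm
    have hadj : ∀ v ∈ s, (H.Adj (ψ.symm (f none)) v ↔ v ∈ U) := fun v hv => by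
      rw [← ψ.map_adj_iff, RelIso.apply_symm_apply, hψ' v hv, f.map_adj_iff]
      rfl
    refine ⟨ψ.symm (f none), fun h => hne (Finset.mem_union_left _ h),
      fun h => hne (Finset.mem_union_right _ h),
      fun u hu => (hadj u (Finset.mem_union_left _ hu)).2 hu, fun w hw h => ?_⟩
    exact Finset.disjoint_left.1 hdisj ((hadj w (Finset.mem_union_right _ hw)).1 h) hw
  · obtain ⟨ψ, hψ⟩ := IsPartialIso.exists_iso hTF hTF hH hH
      (Set.finite_range fun x : (s : Set V) => (x.1, (φ x).1)) (by
        rintro _ ⟨x, rfl⟩ _ ⟨y, rfl⟩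
        refine ⟨?_, (φ.map_adj_iff (v := x) (w := y)).symm⟩
        rw [← Subtype.ext_iff, ← Subtype.ext_iff, φ.injective.eq_iff])
    exact ⟨ψ, fun v hv => hψ _ ⟨⟨v, hv⟩, rfl⟩⟩
end

section
/- (Henson) Let H₃ be a universal triangle-free graph and let c be a coloring of the vertices of H₃ into two colors. Then either there is an induced subgraph of H₃ isomorphic to H₃ all of whose vertices have the first color, or else there is an infinite induced subgraph of H₃ all of whose vertices have the second color and into which every finite triangle-free graph embeds as an induced subgraph. -/
open SimpleGraph in
/-- Greedy embedding: a countable triangle-free graph `G` embeds into `H`, with the `i`-th vertex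
satisfying `P i`, as soon as every one-point extension problem over vertices satisfying the
other predicates is solvable within `P i`. -/
theorem exists_embedding_of_one_point_extension {F V : Type*} [Countable F]
    {G : SimpleGraph F} (hG : G.CliqueFree 3) (H : SimpleGraph V) (P : F → V → Prop)
    (hP : ∀ i, ∀ U W : Finset V, Disjoint U W → (∀ u ∈ U, ∀ u' ∈ U, ¬ H.Adj u u') →
      (∀ x ∈ U, ∃ j ≠ i, P j x) → (∀ x ∈ W, ∃ j ≠ i, P j x) →
      ∃ v, P i v ∧ v ∉ U ∧ v ∉ W ∧ (∀ u ∈ U, H.Adj v u) ∧ ∀ w ∈ W, ¬ H.Adj v w) :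
    ∃ f : G ↪g H, ∀ i, P i (f i) := by
  classical
  rcases isEmpty_or_nonempty F with hF | ⟨⟨i₀⟩⟩
  · exact ⟨⟨⟨isEmptyElim, fun i => isEmptyElim i⟩, fun {i} => isEmptyElim i⟩, isEmptyElim⟩
  obtain ⟨v₀, -⟩ := hP i₀ ∅ ∅ (by simp) (by simp) (by simp) (by simp)
  have : Nonempty V := ⟨v₀⟩
  obtain ⟨e, he⟩ := exists_injective_nat F
  have wf : WellFounded fun i j : F => e i < e j := InvImage.wf e wellFounded_lt
  let Q : ∀ i, (∀ j, e j < e i → V) → V → Prop := fun i g v =>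
    P i v ∧ ∀ j hj, g j hj ≠ v ∧ (G.Adj i j ↔ H.Adj v (g j hj))
  let f : F → V := wf.fix fun i g => Classical.epsilon (Q i g)
  have hf : ∀ i, f i = Classical.epsilon (Q i fun j _ => f j) := fun i => wf.fix_eq _ i
  have key : ∀ i, Q i (fun j _ => f j) (f i) := by
    intro i
    induction i using wf.induction with
    | _ i ih =>
    rw [hf i]
    apply Classical.epsilon_spec
    have hfin : {j | e j < e i}.Finite := (Set.finite_Iio (e i)).preimage he.injOn
    have hadj : ∀ j k, e j < e i → e k < e i → (G.Adj j k ↔ H.Adj (f j) (f k)) := by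
      intro j k hj hk
      rcases lt_trichotomy (e j) (e k) with h | h | h
      · rw [G.adj_comm, H.adj_comm]
        exact ((ih k hk).2 j h).2
      · simp [he h]
      · exact ((ih j hj).2 k h).2
    have hinj : ∀ j k, e j < e i → e k < e i → f j = f k → j = k := by
      intro j k hj hk hjk
      rcases lt_trichotomy (e j) (e k) with h | h | h
      · exact absurd hjk ((ih k hk).2 j h).1
      · exact he h
      · exact absurd hjk.symm ((ih j hj).2 k h).1
    obtain ⟨v, hv, hvU, hvW, hU, hW⟩ := hP i
      ((hfin.toFinset.filter (G.Adj i)).image f) ((hfin.toFinset.filter (¬ G.Adj i ·)).image f)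
      (by
        simp only [Finset.disjoint_left, Finset.mem_image, Finset.mem_filter,
          Set.Finite.mem_toFinset, Set.mem_ofPred_eq]
        rintro _ ⟨j, ⟨hj, hij⟩, rfl⟩ ⟨k, ⟨hk, hik⟩, hkj⟩
        exact hik (hinj k j hk hj hkj ▸ hij))
      (by
        simp only [Finset.mem_image, Finset.mem_filter,
          Set.Finite.mem_toFinset, Set.mem_ofPred_eq]
        rintro _ ⟨j, ⟨hj, hij⟩, rfl⟩ _ ⟨k, ⟨hk, hik⟩, rfl⟩ h
        exact hG {i, j, k} (is3Clique_triple_iff.2 ⟨hij, hik, (hadj j k hj hk).2 h⟩))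
      (by
        simp only [Finset.mem_image, Finset.mem_filter,
          Set.Finite.mem_toFinset, Set.mem_ofPred_eq]
        rintro _ ⟨j, ⟨hj, -⟩, rfl⟩
        exact ⟨j, fun h => hj.ne (congrArg e h), (ih j hj).1⟩)
      (by
        simp only [Finset.mem_image, Finset.mem_filter,
          Set.Finite.mem_toFinset, Set.mem_ofPred_eq]
        rintro _ ⟨j, ⟨hj, -⟩, rfl⟩
        exact ⟨j, fun h => hj.ne (congrArg e h), (ih j hj).1⟩)
    simp only [Finset.mem_image, Finset.mem_filter, Set.Finite.mem_toFinset, Set.mem_ofPred_eq]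
      at hvU hvW hU hW
    refine ⟨v, hv, fun j hj => ?_⟩
    by_cases hij : G.Adj i j
    · exact ⟨fun h => hvU ⟨j, ⟨hj, hij⟩, h⟩, by simp [hij, hU _ ⟨j, ⟨hj, hij⟩, rfl⟩]⟩
    · exact ⟨fun h => hvW ⟨j, ⟨hj, hij⟩, h⟩, by simp [hij, hW _ ⟨j, ⟨hj, hij⟩, rfl⟩]⟩
  refine ⟨⟨⟨f, fun j k hjk => ?_⟩, fun {j k} => ?_⟩, fun i => (key i).1⟩
  · rcases lt_trichotomy (e j) (e k) with h | h | h
    · exact absurd hjk ((key k).2 j h).1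
    · exact he h
    · exact absurd hjk.symm ((key j).2 k h).1
  · change H.Adj (f j) (f k) ↔ G.Adj j k
    rcases lt_trichotomy (e j) (e k) with h | h | h
    · rw [G.adj_comm, H.adj_comm]
      exact ((key k).2 j h).2.symm
    · simp [he h]
    · exact ((key j).2 k h).2.symm

/-- The extension problem `(U, W)`, with `U` independent and disjoint from `W`, is solved in `H`
only by vertices outside of `A`. -/
def AvoidsSolutions {V : Type*} (H : SimpleGraph V) (A : Set V) (p : Finset V × Finset V) : Prop :=
  Disjoint p.1 p.2 ∧ (∀ u ∈ p.1, ∀ u' ∈ p.1, ¬ H.Adj u u') ∧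
    ∀ v, v ∉ p.1 → v ∉ p.2 → (∀ u ∈ p.1, H.Adj v u) → (∀ w ∈ p.2, ¬ H.Adj v w) → v ∉ A

/-- If outside of a finite set all extension problems are solvable in `A`, then every countable
triangle-free graph embeds into `A`. -/
theorem exists_embedding_of_forall_not_avoidsSolutions {F V : Type*} [Countable F]
    {G : SimpleGraph F} (hG : G.CliqueFree 3) (H : SimpleGraph V) {A : Set V} (S : Finset V)
    (hS : ∀ p, AvoidsSolutions H A p → ¬ Disjoint S p.1) :
    ∃ f : G ↪g H, ∀ i, f i ∈ A := by
  classical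
  obtain ⟨f, hf⟩ := exists_embedding_of_one_point_extension hG H (fun _ v => v ∈ A ∧ v ∉ S) (by
    intro i U W hUW hU hUS _
    have hdisj : Disjoint U S := Finset.disjoint_left.2 fun x hx => by
      obtain ⟨_, _, _, h⟩ := hUS x hx
      exact h
    by_contra! hcon
    refine hS (U, W ∪ S) ⟨Finset.disjoint_union_right.2 ⟨hUW, hdisj⟩, hU, ?_⟩ hdisj.symm
    intro v hvU hvW hadj hnadj hvA
    simp only [Finset.mem_union, not_or] at hvW
    obtain ⟨w, hw, h⟩ := hcon v ⟨hvA, hvW.2⟩ hvU hvW.1 hadj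
    exact hnadj w (Finset.mem_union_left _ hw) h)
  exact ⟨f, fun i => (hf i).1⟩

/-- If extension problems avoiding `A` can be found disjointly from any finite set, then every
finite triangle-free graph embeds into the complement of `A`. -/
theorem HensonExtProp.exists_embedding_compl {V : Type} {H : SimpleGraph V}
    (hH : HensonExtProp H) {A : Set V}
    (hA : ∀ S : Finset V, ∃ p, AvoidsSolutions H A p ∧ Disjoint S p.1)
    {F : Type*} [Finite F] {G : SimpleGraph F} (hG : G.CliqueFree 3) :
    ∃ f : G ↪g H, ∀ i, f i ∉ A := by
  classical
  have := Fintype.ofFinite F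
  obtain ⟨q, hq, hlt⟩ := exists_seq_of_forall_finset_exists (AvoidsSolutions H A)
    (fun p p' => Disjoint p.1 p'.1) fun s _ => by
      obtain ⟨p, hp, hdisj⟩ := hA (s.biUnion Prod.fst)
      exact ⟨p, hp, fun x hx => (Finset.disjoint_biUnion_left _ _ _).1 hdisj x hx⟩
  obtain ⟨e, he⟩ := exists_injective_nat F
  let p : F → Finset V × Finset V := fun i => q (e i)
  have hp : ∀ i, AvoidsSolutions H A (p i) := fun i => hq _
  have hdisj : ∀ i j, i ≠ j → Disjoint (p i).1 (p j).1 := fun i j hij =>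
    (he.ne hij).lt_or_gt.elim (hlt _ _) fun h => (hlt _ _ h).symm
  let T : Finset V := Finset.univ.biUnion fun i => (p i).1 ∪ (p i).2
  have hT₁ : ∀ i, ∀ x ∈ (p i).1, x ∈ T := fun i x hx =>
    Finset.mem_biUnion.2 ⟨i, Finset.mem_univ i, Finset.mem_union_left _ hx⟩
  have hT₂ : ∀ i, ∀ x ∈ (p i).2, x ∈ T := fun i x hx =>
    Finset.mem_biUnion.2 ⟨i, Finset.mem_univ i, Finset.mem_union_right _ hx⟩
  obtain ⟨f, hf⟩ := exists_embedding_of_one_point_extension hG H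
    (fun i v => v ∉ A ∧ v ∉ T ∧ ∀ x ∈ T \ (p i).1, ¬ H.Adj v x) (by
    intro i U W hUW hU hUP hWP
    have hUT : ∀ x ∈ U, x ∉ T := fun x hx => by
      obtain ⟨_, _, _, h, _⟩ := hUP x hx
      exact h
    have hWT : ∀ x ∈ W, x ∉ T := fun x hx => by
      obtain ⟨_, _, _, h, _⟩ := hWP x hx
      exact h
    have hUp : ∀ x ∈ U, ∀ y ∈ (p i).1, ¬ H.Adj x y := fun x hx y hy => by
      obtain ⟨j, hji, _, _, h⟩ := hUP x hx
      exact h y (Finset.mem_sdiff.2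
        ⟨hT₁ i y hy, Finset.disjoint_left.1 (hdisj i j hji.symm) hy⟩)
    obtain ⟨v, hvU, hvW, hadj, hnadj⟩ := hH ((p i).1 ∪ U) ((T \ (p i).1) ∪ W)
      (by
        rw [Finset.disjoint_left]
        intro x hx hx'
        simp only [Finset.mem_union, Finset.mem_sdiff] at hx hx'
        rcases hx with hx | hx <;> rcases hx' with hx' | hx'
        · exact hx'.2 hx
        · exact hWT x hx' (hT₁ i x hx)
        · exact hUT x hx hx'.1
        · exact Finset.disjoint_left.1 hUW hx hx')
      (by
        intro x hx y hy
        rw [Finset.mem_union] at hx hy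
        rcases hx with hx | hx <;> rcases hy with hy | hy
        · exact (hp i).2.1 x hx y hy
        · exact fun h => hUp y hy x hx h.symm
        · exact hUp x hx y hy
        · exact hU x hx y hy)
    simp only [Finset.mem_union, Finset.mem_sdiff, not_or, not_and, not_not] at hvU hvW hadj hnadj
    have hvT : v ∉ T := fun h => hvU.1 (hvW.1 h)
    refine ⟨v, ⟨(hp i).2.2 v hvU.1 (fun h => hvT (hT₂ i v h)) (fun u hu => hadj u (.inl hu))
      fun w hw => hnadj w (.inl ⟨hT₂ i w hw, fun h => Finset.disjoint_left.1 (hp i).1 h hw⟩),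
      hvT, fun x hx => hnadj x (.inl (Finset.mem_sdiff.1 hx))⟩, hvU.2, hvW.2,
      fun u hu => hadj u (.inr hu), fun w hw => hnadj w (.inr hw)⟩)
  exact ⟨f, fun i => (hf i).1⟩

/-- **Henson.** Let `H₃` be a universal triangle-free graph and `c` a coloring of its
vertices into two colors.  Then either there is an induced subgraph of `H₃` isomorphic to
`H₃` all of whose vertices get the first color, or else there is an infinite induced
subgraph of `H₃` all of whose vertices get the second color and into which every finite
triangle-free graph embeds as an induced subgraph. -/
theorem henson_vertex_dichotomy {V : Type} [Countable V] (H : SimpleGraph V)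
    (hTF : H.CliqueFree 3) (hH : HensonExtProp H) (c : V → Fin 2) :
    (∃ W : Set V, (∀ v ∈ W, c v = 0) ∧ Nonempty (H ≃g H.induce W)) ∨
    (∃ W : Set V, W.Infinite ∧ (∀ v ∈ W, c v = 1) ∧
      ∀ (F : Type) [Fintype F], ∀ G : SimpleGraph F, G.CliqueFree 3 →
        Nonempty (G ↪g H.induce W)) := by
  classical
  by_cases hS : ∃ S : Finset V, ∀ p, AvoidsSolutions H {v | c v = 0} p → ¬ Disjoint S p.1
  · obtain ⟨S, hS⟩ := hS
    obtain ⟨f, hf⟩ := exists_embedding_of_forall_not_avoidsSolutions hTF H S hS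
    refine .inl ⟨Set.range f, ?_, ⟨⟨Equiv.ofInjective f f.injective, f.map_rel_iff⟩⟩⟩
    rintro _ ⟨i, rfl⟩
    exact hf i
  · push Not at hS
    have hemb : ∀ (F : Type) [Finite F], ∀ G : SimpleGraph F, G.CliqueFree 3 →
        Nonempty (G ↪g H.induce {v | c v = 1}) := by
      intro F _ G hG
      obtain ⟨f, hf⟩ := hH.exists_embedding_compl hS hG
      have hf' : ∀ i, c (f i) = 1 := fun i => Fin.eq_one_of_ne_zero _ (hf i)
      exact ⟨⟨⟨fun i => ⟨f i, hf' i⟩, fun i j h => f.injective (congrArg Subtype.val h)⟩,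
        f.map_rel_iff⟩⟩
    refine .inr ⟨{v | c v = 1}, ?_, fun v hv => hv, fun F _ G hG => hemb F G hG⟩
    rw [← Set.infinite_coe_iff, ← not_finite_iff_infinite]
    intro hfin
    obtain ⟨f⟩ := hemb (Fin (Nat.card {v | c v = 1} + 1)) ⊥ (SimpleGraph.cliqueFree_bot (by simp))
    have := Nat.card_le_card_of_injective f f.injective
    simp at this
end
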